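/- For any ε > 0 there exist δ = δ(ε) > 0 and a constant C = C(ε) such that for every λ with 0 < λ < 1 + δ and every real X ≥ 2, the number N_λ(X) of abc triples of exponent λ with entries at most X satisfies N_λ(X) ≤ C · X^(56/85 + ε). -/

import Mathlib

open Finset

/-- The radical of a positive integer: the product of its distinct prime factors. -/
def rad (n : ℕ) : ℕ := ∏ p ∈ n.primeFactors, p

/-- `(a,b,c)` is an abc triple of exponent `lam`: positive coprime integers with
`a + b = c` and `rad (a*b*c) < c ^ lam`. -/
def IsABCTriple (lam : ℝ) (a b c : ℕ) : Prop :=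
  0 < a ∧ 0 < b ∧ 0 < c ∧ Nat.gcd a b = 1 ∧ a + b = c ∧
    (rad (a * b * c) : ℝ) < (c : ℝ) ^ lam

/-- `NabcCount lam X` is the number of abc triples of exponent `lam` with all entries
at most `X`. -/
noncomputable def NabcCount (lam X : ℝ) : ℕ :=
  Set.ncard {t : ℕ × ℕ × ℕ | IsABCTriple lam t.1 t.2.1 t.2.2 ∧
    (t.1 : ℝ) ≤ X ∧ (t.2.1 : ℝ) ≤ X ∧ (t.2.2 : ℝ) ≤ X}

theorem Nat.exists_card_divisors_le_rpow {ε : ℝ} (hε : 0 < ε) :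
    ∃ C : ℝ, 1 ≤ C ∧ ∀ n : ℕ, n ≠ 0 → (#n.divisors : ℝ) ≤ C * (n : ℝ) ^ ε := by
  obtain ⟨B, hB⟩ := exists_nat_gt ((2 : ℝ) ^ (1 / ε))
  set K : ℝ := 1 + 1 / (ε * Real.log 2) with hK
  have hlog : 0 < Real.log 2 := Real.log_pos (by norm_num)
  have hK1 : 1 ≤ K := by rw [hK]; have : 0 < 1 / (ε * Real.log 2) := by positivity
                         linarith
  have small : ∀ p : ℕ, 2 ≤ p → ∀ k : ℕ, (k + 1 : ℝ) ≤ K * ((p : ℝ) ^ k) ^ ε := by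
    intro p hp k
    have h1 : (2 : ℝ) ^ (k * ε) ≤ ((p : ℝ) ^ k) ^ ε := by
      rw [Real.rpow_mul (by norm_num), Real.rpow_natCast]
      gcongr
      exact_mod_cast hp
    have h2 : 1 + k * ε * Real.log 2 ≤ (2 : ℝ) ^ (k * ε) := by
      rw [Real.rpow_def_of_pos (by norm_num)]
      have := Real.add_one_le_exp (Real.log 2 * (k * ε))
      linarith
    have h3 : (k + 1 : ℝ) ≤ K * (1 + k * ε * Real.log 2) := by
      have : K * (1 + k * ε * Real.log 2) =
          1 + k + (1 / (ε * Real.log 2) + k * ε * Real.log 2) := by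
        rw [hK]; field_simp; ring
      rw [this]
      have : 0 ≤ 1 / (ε * Real.log 2) + k * ε * Real.log 2 := by positivity
      linarith
    exact h3.trans (mul_le_mul_of_nonneg_left (h2.trans h1) (by linarith))
  have large : ∀ p : ℕ, B ≤ p → ∀ k : ℕ, (k + 1 : ℝ) ≤ ((p : ℝ) ^ k) ^ ε := by
    intro p hp k
    have h1 : (2 : ℝ) ≤ (p : ℝ) ^ ε := by
      calc (2 : ℝ) = ((2 : ℝ) ^ (1 / ε)) ^ ε := by
            rw [← Real.rpow_mul (by norm_num)]; field_simp; simp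
        _ ≤ (p : ℝ) ^ ε := by
            gcongr
            exact hB.le.trans (by exact_mod_cast hp)
    have h2 : (k + 1 : ℝ) ≤ 2 ^ k := by exact_mod_cast Nat.lt_two_pow_self
    calc (k + 1 : ℝ) ≤ 2 ^ k := h2
      _ ≤ ((p : ℝ) ^ ε) ^ k := by gcongr
      _ = ((p : ℝ) ^ k) ^ ε := by
        rw [← Real.rpow_natCast, ← Real.rpow_natCast, ← Real.rpow_mul (by positivity),
          ← Real.rpow_mul (by positivity), mul_comm]
  refine ⟨K ^ B, one_le_pow₀ hK1, fun n hn => ?_⟩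
  have hn' : (n : ℝ) ^ ε = ∏ p ∈ n.primeFactors, ((p : ℝ) ^ n.factorization p) ^ ε := by
    rw [Real.finsetProd_rpow _ _ (fun i _ => by positivity)]
    congr 1
    conv_lhs => rw [← Nat.prod_factorization_pow_eq_self hn]
    rw [Finsupp.prod]
    push_cast
    rfl
  rw [Nat.card_divisors hn, hn']
  push_cast
  have hC : ∏ p ∈ n.primeFactors, (if p < B then K else 1) ≤ K ^ B := by
    rw [prod_ite, prod_const, prod_const_one, mul_one]
    apply pow_le_pow_right₀ hK1
    calc _ ≤ #(range B) := card_le_card (fun p hp => by simp at hp ⊢; exact hp.2)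
      _ = B := card_range B
  calc _ ≤ ∏ p ∈ n.primeFactors, ((if p < B then K else 1) *
        ((p : ℝ) ^ n.factorization p) ^ ε) := by
        apply prod_le_prod
        · intros; positivity
        · intro p hp
          split_ifs with h
          · exact small p (Nat.prime_of_mem_primeFactors hp).two_le _
          · rw [one_mul]; exact large p (not_lt.mp h) _
    _ ≤ _ := by
        rw [prod_mul_distrib]
        gcongr

theorem Nat.two_pow_card_primeFactors_le {n : ℕ} (hn : n ≠ 0) :
    2 ^ #n.primeFactors ≤ #n.divisors := by
  rw [Nat.card_divisors hn, ← prod_const]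
  apply prod_le_prod'
  intro p hp
  have := (Nat.prime_of_mem_primeFactors hp).factorization_pos_of_dvd hn
    (Nat.dvd_of_mem_primeFactors hp)
  lia

/-- The product of the primes which divide `n` exactly `i` times. -/
def exactPart (i n : ℕ) : ℕ := ∏ p ∈ n.primeFactors with n.factorization p = i, p

/-- The part of `n` made up of the prime powers with exponent at least `6`. -/
def tailPart (n : ℕ) : ℕ := ∏ p ∈ n.primeFactors with 6 ≤ n.factorization p, p ^ n.factorization p

theorem prod_primeFactors_eq_mul_tail (n : ℕ) (F : ℕ → ℕ) :
    ∏ p ∈ n.primeFactors, F p =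
      (∏ i ∈ Icc 1 5, ∏ p ∈ n.primeFactors with n.factorization p = i, F p) *
        ∏ p ∈ n.primeFactors with 6 ≤ n.factorization p, F p := by
  rw [← prod_filter_mul_prod_filter_not n.primeFactors (6 ≤ n.factorization ·), mul_comm]
  congr 1
  rw [← prod_fiberwise_of_maps_to (t := Icc 1 5) (g := n.factorization)]
  · refine prod_congr rfl fun i hi => prod_congr ?_ fun _ _ => rfl
    ext p
    simp only [mem_filter, mem_Icc] at hi ⊢
    grind
  · intro p hp
    simp only [mem_filter, mem_Icc] at hp ⊢
    have := (Nat.prime_of_mem_primeFactors hp.1).factorization_pos_of_dvd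
      (Nat.mem_primeFactors.mp hp.1).2.2 (Nat.dvd_of_mem_primeFactors hp.1)
    lia

theorem exactPart_pos (i n : ℕ) : 0 < exactPart i n :=
  prod_pos fun _ hp => (Nat.prime_of_mem_primeFactors (mem_filter.mp hp).1).pos

theorem tailPart_pos (n : ℕ) : 0 < tailPart n :=
  prod_pos fun _ hp => pow_pos (Nat.prime_of_mem_primeFactors (mem_filter.mp hp).1).pos _

theorem rad_pos (n : ℕ) : 0 < rad n :=
  prod_pos fun _ hp => (Nat.prime_of_mem_primeFactors hp).pos

theorem prod_exactPart_pow_mul_tailPart {n : ℕ} (hn : n ≠ 0) :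
    (∏ i ∈ Icc 1 5, exactPart i n ^ i) * tailPart n = n := by
  conv_rhs => rw [← Nat.prod_factorization_pow_eq_self hn, Finsupp.prod,
    Nat.support_factorization, prod_primeFactors_eq_mul_tail]
  rw [tailPart]
  congr 1
  refine prod_congr rfl fun i _ => ?_
  rw [exactPart, ← prod_pow]
  exact prod_congr rfl fun p hp => by rw [(mem_filter.mp hp).2]

theorem rad_tailPart (n : ℕ) :
    rad (tailPart n) = ∏ p ∈ n.primeFactors with 6 ≤ n.factorization p, p := by
  rw [rad]
  congr 1
  ext q
  rw [Nat.mem_primeFactors, mem_filter]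
  constructor
  · rintro ⟨hq, hdvd, -⟩
    obtain ⟨p, hp, hqp⟩ := (hq.prime.dvd_finsetProd_iff _).mp hdvd
    have hp' := Nat.prime_of_mem_primeFactors (mem_filter.mp hp).1
    rw [(Nat.prime_dvd_prime_iff_eq hq hp').mp (hq.dvd_of_dvd_pow hqp)]
    exact mem_filter.mp hp
  · intro hq
    exact ⟨Nat.prime_of_mem_primeFactors hq.1,
      (dvd_pow_self q (by lia)).trans (dvd_prod_of_mem (fun p => p ^ n.factorization p)
        (mem_filter.mpr hq)), (tailPart_pos n).ne'⟩

theorem rad_eq_prod_exactPart_mul (n : ℕ) :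
    rad n = (∏ i ∈ Icc 1 5, exactPart i n) * rad (tailPart n) := by
  rw [rad_tailPart, rad, prod_primeFactors_eq_mul_tail]
  rfl

theorem rad_tailPart_pow_le (n : ℕ) : rad (tailPart n) ^ 6 ≤ tailPart n := by
  rw [rad_tailPart, ← prod_pow, tailPart]
  exact prod_le_prod' fun p hp => Nat.pow_le_pow_right
    (Nat.prime_of_mem_primeFactors (mem_filter.mp hp).1).pos (mem_filter.mp hp).2

theorem rad_dvd (n : ℕ) : rad n ∣ n := Nat.prod_primeFactors_dvd n

theorem Nat.dvd_rad_pow_mul_floorRoot_pow {n k : ℕ} (hn : n ≠ 0) (hk : k ≠ 0) :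
    n / Nat.floorRoot k n ^ k ∣ rad n ^ k := by
  have h0 : n / Nat.floorRoot k n ^ k ≠ 0 :=
    (Nat.div_pos (Nat.le_of_dvd (by lia) Nat.floorRoot_pow_dvd)
      (pow_pos (Nat.pos_of_ne_zero (Nat.floorRoot_ne_zero.mpr ⟨hk, hn⟩)) k)).ne'
  rw [← Nat.factorization_le_iff_dvd h0 (pow_pos (rad_pos n) k).ne']
  intro p
  rw [Nat.factorization_div Nat.floorRoot_pow_dvd, Nat.factorization_pow, Nat.factorization_pow,
    Nat.factorization_floorRoot]
  simp only [Finsupp.coe_tsub, Pi.sub_apply, Finsupp.smul_apply, smul_eq_mul]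
  by_cases hp : p ∈ n.primeFactors
  · have h1 : 1 ≤ (rad n).factorization p :=
      (Nat.prime_of_mem_primeFactors hp).factorization_pos_of_dvd (rad_pos n).ne'
        (dvd_prod_of_mem (fun p => p) hp)
    have h2 : (n.factorization ⌊/⌋ k) p = n.factorization p / k := by
      simp [Finsupp.floorDiv_apply, Nat.floorDiv_eq_div]
    rw [h2]
    have h3 := Nat.div_add_mod (n.factorization p) k
    have h4 := Nat.mod_lt (n.factorization p) (Nat.pos_of_ne_zero hk)
    have h5 := Nat.mul_le_mul_left k h1
    lia
  · rw [← Nat.support_factorization, Finsupp.notMem_support_iff] at hp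
    rw [hp]
    simp

theorem exists_card_rad_eq_le {η : ℝ} (hη : 0 < η) :
    ∃ C : ℝ, 1 ≤ C ∧ ∀ X m : ℕ, 1 ≤ X → (#{n ∈ Icc 1 X | rad n = m} : ℝ) ≤ C * (X : ℝ) ^ η := by
  set k := ⌈2 / η⌉₊
  have hk : 2 / η ≤ k := Nat.le_ceil _
  have hk0 : (0 : ℝ) < k := lt_of_lt_of_le (by positivity) hk
  have hk0' : k ≠ 0 := by exact_mod_cast hk0.ne'
  obtain ⟨C, hC1, hC⟩ := Nat.exists_card_divisors_le_rpow (ε := η / (2 * k)) (by positivity)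
  refine ⟨C, hC1, fun X m hX => ?_⟩
  have hX' : (1 : ℝ) ≤ X := by exact_mod_cast hX
  set S := {n ∈ Icc 1 X | rad n = m}
  have hS : ∀ n ∈ S, n ≠ 0 ∧ n ≤ X ∧ rad n = m := fun n hn => by
    simp only [S, mem_filter, mem_Icc] at hn
    exact ⟨by lia, hn.1.2, hn.2⟩
  rcases S.eq_empty_or_nonempty with h | ⟨n₀, hn₀⟩
  · rw [h, card_empty, Nat.cast_zero]
    positivity
  have hm0 : 0 < m := (hS n₀ hn₀).2.2 ▸ rad_pos n₀
  have hmX : m ≤ X := by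
    obtain ⟨h1, h2, h3⟩ := hS n₀ hn₀
    exact (Nat.le_of_dvd (by lia) (h3 ▸ rad_dvd n₀)).trans h2
  have h_inj : #S ≤ #(Icc 1 ⌊(X : ℝ) ^ (1 / k : ℝ)⌋₊ ×ˢ (m ^ k).divisors) := by
    refine card_le_card_of_injOn (fun n => (Nat.floorRoot k n, n / Nat.floorRoot k n ^ k)) ?_ ?_
    · intro n hn
      obtain ⟨h1, h2, h3⟩ := hS n hn
      simp only [coe_product, Set.mem_prod, mem_coe, mem_Icc, Nat.mem_divisors]
      refine ⟨⟨Nat.pos_of_ne_zero (Nat.floorRoot_ne_zero.mpr ⟨hk0', h1⟩), ?_⟩,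
        h3 ▸ Nat.dvd_rad_pow_mul_floorRoot_pow h1 hk0', by positivity⟩
      refine Nat.le_floor ?_
      rw [one_div, Real.le_rpow_inv_iff_of_pos (by positivity) (by positivity) hk0,
        Real.rpow_natCast]
      exact_mod_cast (Nat.le_of_dvd (by lia) Nat.floorRoot_pow_dvd).trans h2
    · intro x _ y _ h
      simp only [Prod.mk.injEq] at h
      rw [← Nat.mul_div_cancel' (Nat.floorRoot_pow_dvd (n := k) (a := x)), h.2, h.1,
        Nat.mul_div_cancel' Nat.floorRoot_pow_dvd]
  calc (#S : ℝ) ≤ (#(Icc 1 ⌊(X : ℝ) ^ (1 / k : ℝ)⌋₊ ×ˢ (m ^ k).divisors) : ℕ) := by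
        exact_mod_cast h_inj
    _ = (⌊(X : ℝ) ^ (1 / k : ℝ)⌋₊ : ℝ) * (#(m ^ k).divisors : ℝ) := by
        rw [card_product, Nat.card_Icc]
        push_cast
        simp
    _ ≤ (X : ℝ) ^ (1 / k : ℝ) * (C * (X : ℝ) ^ (η / 2)) := by
        gcongr
        · exact Nat.floor_le (by positivity)
        · refine (hC _ (by positivity)).trans ?_
          gcongr
          push_cast
          calc ((m : ℝ) ^ k) ^ (η / (2 * k)) ≤ ((X : ℝ) ^ k) ^ (η / (2 * k)) := by gcongr
            _ = (X : ℝ) ^ (η / 2) := by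
              rw [← Real.rpow_natCast, ← Real.rpow_mul (by positivity)]
              congr 1
              field_simp
    _ = C * (X : ℝ) ^ (1 / k + η / 2 : ℝ) := by rw [Real.rpow_add (by positivity)]; ring
    _ ≤ C * (X : ℝ) ^ η := by
        have : (1 : ℝ) / k ≤ η / 2 := by
          rw [div_le_div_iff₀ hk0 (by norm_num)]
          rw [div_le_iff₀ hη] at hk
          linarith
        gcongr
        linarith

theorem Subgroup.card_ker_powMonoidHom_le_index_mul {G : Type*} [CommGroup G] [Finite G]
    (H : Subgroup G) [IsCyclic H] {g : ℕ} (hg : 0 < g) :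
    Nat.card (powMonoidHom g : G →* G).ker ≤ H.index * g := by
  classical
  set K := (powMonoidHom g : G →* G).ker
  have h1 := Subgroup.card_mul_index (H.subgroupOf K)
  have h2 : (H.subgroupOf K).index ≤ H.index :=
    (Subgroup.relIndex_le_of_le_right (H := H) (K := K) (L := ⊤) le_top
      (by rw [Subgroup.relIndex_top_right]; exact Subgroup.index_ne_zero_of_finite)).trans_eq
      (Subgroup.relIndex_top_right H)
  have h3 : Nat.card (H.subgroupOf K) ≤ g := by
    have := Fintype.ofFinite H
    have h4 : Nat.card {a : H // a ^ g = 1} ≤ g := by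
      rw [Nat.card_eq_fintype_card, Fintype.card_subtype]
      exact IsCyclic.card_pow_eq_one_le (α := H) hg
    refine le_trans (Nat.card_le_card_of_injective
      (fun x => (⟨⟨x.1.1, x.2⟩, Subtype.ext x.1.2⟩ : {a : H // a ^ g = 1})) ?_) h4
    intro x y h
    simp only [Subtype.mk.injEq] at h
    have h5 : ((x : K) : G) = (y : K) := by simpa only [Subtype.ext_iff] using h
    exact Subtype.ext (Subtype.ext h5)
  rw [← h1, mul_comm]
  exact Nat.mul_le_mul h2 h3

theorem ZMod.exists_index_zpowers_le_two {p k : ℕ} (hp : p.Prime) :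
    ∃ u : (ZMod (p ^ k))ˣ, (Subgroup.zpowers u).index ≤ 2 := by
  have : NeZero (p ^ k) := ⟨(pow_pos hp.pos k).ne'⟩
  by_cases hc : IsCyclic (ZMod (p ^ k))ˣ
  · obtain ⟨u, hu⟩ := hc.exists_generator
    refine ⟨u, ?_⟩
    rw [(Subgroup.eq_top_iff' _).mpr hu, Subgroup.index_top]
    norm_num
  have h2 : p = 2 := by
    by_contra h
    exact hc (ZMod.isCyclic_units_of_prime_pow p hp h k)
  subst h2
  rw [ZMod.isCyclic_units_two_pow_iff, not_le] at hc
  obtain ⟨n, rfl⟩ : ∃ n, k = n + 2 := ⟨k - 2, by lia⟩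
  have h5 := ZMod.orderOf_five n
  have hu : IsUnit (5 : ZMod (2 ^ (n + 2))) := by
    have : ((5 : ℕ) : ZMod (2 ^ (n + 2))) = 5 := by norm_num
    rw [← this, ZMod.isUnit_iff_coprime]
    exact Nat.Coprime.pow_right _ (by norm_num)
  obtain ⟨u, hu⟩ := hu
  refine ⟨u, ?_⟩
  have h1 := Subgroup.card_mul_index (Subgroup.zpowers u)
  rw [Nat.card_zpowers, ← orderOf_units, hu, h5, Nat.card_eq_fintype_card,
    ZMod.card_units_eq_totient, Nat.totient_prime_pow_succ Nat.prime_two] at h1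
  have : 2 ^ n * (Subgroup.zpowers u).index = 2 ^ n * 2 := by rw [h1]; ring
  exact (Nat.eq_of_mul_eq_mul_left (by positivity) this).le

theorem ZMod.card_ker_powMonoidHom_le {g : ℕ} (hg : 0 < g) {n : ℕ} (hn : n ≠ 0) :
    Nat.card (powMonoidHom g : (ZMod n)ˣ →* (ZMod n)ˣ).ker ≤ (2 * g) ^ #n.primeFactors := by
  induction n using Nat.recOnPosPrimePosCoprime with
  | prime_pow p k hp hk =>
    have : NeZero (p ^ k) := ⟨hn⟩
    obtain ⟨u, hu⟩ := ZMod.exists_index_zpowers_le_two (k := k) hp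
    rw [Nat.primeFactors_prime_pow hk.ne' hp, card_singleton, pow_one]
    exact (Subgroup.card_ker_powMonoidHom_le_index_mul _ hg).trans (Nat.mul_le_mul_right g hu)
  | zero => exact absurd rfl hn
  | one =>
    have : Subsingleton (ZMod 1)ˣ := inferInstance
    exact (Finite.card_le_one_iff_subsingleton.mpr inferInstance).trans (by simp)
  | coprime a b ha hb hab iha ihb =>
    have : NeZero a := ⟨by lia⟩
    have : NeZero b := ⟨by lia⟩
    rw [hab.primeFactors_mul, card_union_of_disjoint hab.disjoint_primeFactors, pow_add]
    refine le_trans ?_ (Nat.mul_le_mul (iha (by lia)) (ihb (by lia)))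
    let e : (ZMod (a * b))ˣ ≃* (ZMod a)ˣ × (ZMod b)ˣ :=
      (Units.mapEquiv (ZMod.chineseRemainder hab).toMulEquiv).trans MulEquiv.prodUnits
    rw [← Nat.card_prod]
    refine Nat.card_le_card_of_injective
      (fun x => (⟨(e x.1).1, ?_⟩, ⟨(e x.1).2, ?_⟩)) ?_
    · have := x.2
      rw [MonoidHom.mem_ker, powMonoidHom_apply] at this ⊢
      rw [← Prod.pow_fst, ← map_pow, this, map_one, Prod.fst_one]
    · have := x.2
      rw [MonoidHom.mem_ker, powMonoidHom_apply] at this ⊢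
      rw [← Prod.pow_snd, ← map_pow, this, map_one, Prod.snd_one]
    · intro x y h
      simp only [Prod.mk.injEq, Subtype.mk.injEq] at h
      exact Subtype.ext (e.injective (Prod.ext h.1 h.2))

/-- In an interval of length `H`, the number of `x` coprime to `f` whose `g`-th power has a given
residue class modulo `f`. -/
theorem Nat.card_pow_modEq_le {S : Finset ℕ} {f H g a : ℕ} (hf : f ≠ 0)
    (hS : ∀ x ∈ S, x ≤ H ∧ x.Coprime f ∧ x ^ g ≡ a ^ g [MOD f]) (ha : a.Coprime f) :
    #S ≤ (H / f + 1) * Nat.card (powMonoidHom g : (ZMod f)ˣ →* (ZMod f)ˣ).ker := by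
  classical
  have : NeZero f := ⟨hf⟩
  let K := (powMonoidHom g : (ZMod f)ˣ →* (ZMod f)ˣ).ker
  have : Fintype K := Fintype.ofFinite K
  rw [Nat.card_eq_fintype_card, ← Finset.card_range (H / f + 1), ← Finset.card_univ,
    ← card_product, ← Finset.card_attach (s := S)]
  refine card_le_card_of_injOn (fun x => (x.1 / f, ⟨ZMod.unitOfCoprime x.1 (hS x.1 x.2).2.1 *
    (ZMod.unitOfCoprime a ha)⁻¹, ?_⟩)) ?_ ?_
  · rw [MonoidHom.mem_ker, powMonoidHom_apply, mul_pow, inv_pow, mul_inv_eq_one]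
    ext
    simp only [Units.val_pow_eq_pow_val, ZMod.coe_unitOfCoprime]
    exact_mod_cast (ZMod.natCast_eq_natCast_iff _ _ _).mpr (hS x.1 x.2).2.2
  · intro x _
    simp only [coe_product, Set.mem_prod, mem_coe, mem_range, mem_univ, and_true]
    exact Nat.lt_succ_of_le (Nat.div_le_div_right (hS x.1 x.2).1)
  · intro x _ y _ h
    simp only [Prod.mk.injEq, Subtype.mk.injEq, mul_left_inj] at h
    have h2 := congrArg Units.val h.2
    simp only [ZMod.coe_unitOfCoprime] at h2
    have h3 : x.1 % f = y.1 % f := (ZMod.natCast_eq_natCast_iff _ _ _).mp h2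
    apply Subtype.ext
    rw [← Nat.div_add_mod x.1 f, ← Nat.div_add_mod y.1 f, h.1, h3]

/-- Given a positive difference of two `g`-th powers, `g ≥ 2`, the two bases are determined by
their difference, which is a divisor. -/
theorem Nat.card_pow_sub_pow_eq_le {S : Finset (ℕ × ℕ)} {g m : ℕ} (hg : 2 ≤ g) (hm : m ≠ 0)
    (hS : ∀ x ∈ S, x.2 ^ g + m = x.1 ^ g) : #S ≤ #m.divisors := by
  have hlt : ∀ x ∈ S, x.2 < x.1 := fun x hx =>
    lt_of_pow_lt_pow_left₀ g (Nat.zero_le _) (by have := hS x hx; lia)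
  have key : ∀ d x y : ℕ, 0 < d → x < y → (x + d) ^ g + y ^ g < (y + d) ^ g + x ^ g := by
    intro d x y hd hxy
    clear hS
    induction g, hg using Nat.le_induction with
    | base => nlinarith
    | succ k _ ih =>
      have h1 : x ^ k ≤ y ^ k := Nat.pow_le_pow_left hxy.le k
      have h2 : x ^ k ≤ (x + d) ^ k := Nat.pow_le_pow_left (by lia) k
      obtain ⟨m, hm⟩ := Nat.exists_eq_add_of_le h2
      have h3 : y ^ k ≤ (y + d) ^ k := Nat.pow_le_pow_left (by lia) k
      obtain ⟨l, hl⟩ := Nat.exists_eq_add_of_le h3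
      rw [hm, hl] at ih
      simp only [pow_succ, hm, hl]
      have h4 : m < l := by lia
      nlinarith [Nat.mul_le_mul_left d h1, mul_lt_mul'' h4 hxy, mul_lt_mul_of_pos_right h4 hd]
  refine card_le_card_of_injOn (fun x => x.1 - x.2) ?_ ?_
  · intro x hx
    simp only [mem_coe, Nat.mem_divisors]
    refine ⟨?_, hm⟩
    have h1 : m = x.1 ^ g - x.2 ^ g := by have := hS x hx; lia
    rw [h1]
    exact Nat.sub_dvd_pow_sub_pow _ _ _
  · intro x hx y hy h
    simp only [] at h
    have h1 := hlt x hx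
    have h2 := hlt y hy
    have h3 := hS x hx
    have h4 := hS y hy
    have hx1 : x.1 = x.2 + (x.1 - x.2) := by lia
    have hy1 : y.1 = y.2 + (x.1 - x.2) := by lia
    rw [hx1] at h3
    rw [hy1] at h4
    have h5 : x.2 = y.2 := by
      rcases lt_trichotomy x.2 y.2 with h | h | h
      · have := key (x.1 - x.2) _ _ (by lia) h; lia
      · exact h
      · have := key (x.1 - x.2) _ _ (by lia) h; lia
    exact Prod.ext (by lia) h5

/-- A Cauchy–Schwarz inequality: control the number of elements by the number of pairs which agree
under two maps. -/
theorem Finset.sq_card_le_of_card_pairs_le {α β γ : Type*} [DecidableEq β] [DecidableEq γ]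
    (T : Finset α) (φ : α → β) (ρ : α → γ) {W : ℕ}
    (hW : ∀ u, #{x ∈ T.filter (φ · = u) ×ˢ T.filter (φ · = u) | ρ x.1 = ρ x.2} ≤ W) :
    #T ^ 2 ≤ #(T.image φ) ^ 2 * #(T.image ρ) * W := by
  classical
  set M := T.image φ
  set R := T.image ρ
  have h1 : #T = ∑ z ∈ M ×ˢ R, #{t ∈ T | (φ t, ρ t) = z} :=
    card_eq_sum_card_fiberwise (fun t ht => by
      simp only [coe_product, Set.mem_prod, mem_coe]
      exact ⟨mem_image_of_mem φ ht, mem_image_of_mem ρ ht⟩)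
  have h2 : ∀ u, ∑ v ∈ R, #{t ∈ T | (φ t, ρ t) = (u, v)} ^ 2 ≤ W := by
    intro u
    refine le_trans ?_ (hW u)
    rw [card_eq_sum_card_fiberwise (f := fun x => ρ x.1) (t := R)]
    · refine sum_le_sum fun v _ => ?_
      rw [sq, ← card_product]
      refine card_le_card fun x hx => ?_
      simp only [mem_product, mem_filter, Prod.mk.injEq] at hx ⊢
      grind
    · intro x hx
      simp only [mem_coe, mem_product, mem_filter] at hx
      exact mem_image_of_mem ρ hx.1.1.1
  calc #T ^ 2 = (∑ z ∈ M ×ˢ R, #{t ∈ T | (φ t, ρ t) = z}) ^ 2 := by rw [← h1]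
    _ ≤ #(M ×ˢ R) * ∑ z ∈ M ×ˢ R, #{t ∈ T | (φ t, ρ t) = z} ^ 2 := sq_sum_le_card_mul_sum_sq
    _ = #M * #R * ∑ u ∈ M, ∑ v ∈ R, #{t ∈ T | (φ t, ρ t) = (u, v)} ^ 2 := by
      rw [card_product, sum_product]
    _ ≤ #M * #R * (#M * W) := by
      gcongr
      exact sum_le_card_nsmul _ _ _ (fun u _ => h2 u)
    _ = _ := by ring

theorem Finset.card_pairs_le_of_congr {T : Finset (ℕ × ℕ × ℕ)} {e f g H : ℕ} {σ τ : ℤ}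
    {A B : ℕ → ℕ} (hσ : IsUnit σ) (hτ : IsUnit τ) (hf : f ≠ 0)
    (rel : ∀ t ∈ T, (t.2.2 : ℤ) = σ * t.1 + τ * t.2.1) (cop : ∀ t ∈ T, t.1.Coprime t.2.1)
    (hp : ∀ t ∈ T, t.1 = e * A t.1 ^ g) (hq : ∀ t ∈ T, t.2.1 = f * B t.2.1) (hg : g ≠ 0)
    (hH : ∀ t ∈ T, A t.1 ≤ H) :
    #{x ∈ T ×ˢ T | x.1.2.2 = x.2.2.2} ≤
      (H / f + 1) * Nat.card (powMonoidHom g : (ZMod f)ˣ →* (ZMod f)ˣ).ker * #T := by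
  have hcop : ∀ t ∈ T, e.Coprime f ∧ (A t.1).Coprime f := by
    intro t ht
    have h1 := cop t ht
    rw [hp t ht, hq t ht] at h1
    have h2 := h1.coprime_mul_right_right
    exact ⟨h2.coprime_mul_right, (Nat.coprime_pow_left_iff (by lia) _ _).mp h2.coprime_mul_left⟩
  refine card_le_mul_card_image_of_maps_to (f := Prod.fst)
    (fun x hx => (mem_product.mp (mem_filter.mp hx).1).1) _ fun t ht => ?_
  rw [← card_image_of_injOn (f := fun x => A x.2.1)]
  · refine Nat.card_pow_modEq_le (a := A t.1) hf (fun n hn => ?_) (hcop t ht).2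
    simp only [mem_image, mem_filter, mem_product] at hn
    obtain ⟨⟨t1, t2⟩, ⟨⟨⟨-, h2⟩, h3⟩, rfl⟩, rfl⟩ := hn
    simp only at *
    refine ⟨hH _ h2, (hcop _ h2).2, ?_⟩
    have h4 : (f : ℤ) ∣ e * ((A t1.1 : ℤ) ^ g - (A t2.1 : ℤ) ^ g) := by
      have e1 := rel t1 ht
      have e2 := rel t2 h2
      have p1 : (t1.1 : ℤ) = e * (A t1.1 : ℤ) ^ g := by exact_mod_cast hp t1 ht
      have p2 : (t2.1 : ℤ) = e * (A t2.1 : ℤ) ^ g := by exact_mod_cast hp t2 h2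
      have q1 : (t1.2.1 : ℤ) = f * (B t1.2.1 : ℤ) := by exact_mod_cast hq t1 ht
      have q2 : (t2.2.1 : ℤ) = f * (B t2.2.1 : ℤ) := by exact_mod_cast hq t2 h2
      rw [mul_sub, ← p1, ← p2, ← hσ.dvd_mul_left]
      have : σ * ((t1.1 : ℤ) - t2.1) = τ * (f * (B t2.2.1 : ℤ) - f * (B t1.2.1 : ℤ)) := by
        rw [← q1, ← q2]
        have : ((t1.2.2 : ℕ) : ℤ) = t2.2.2 := by rw [h3]
        linarith
      rw [this]
      exact Dvd.intro _ (by ring : (f : ℤ) * (τ * (B t2.2.1 - B t1.2.1)) = _)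
    have h5 : (f : ℤ) ∣ (A t1.1 : ℤ) ^ g - (A t2.1 : ℤ) ^ g :=
      (Nat.isCoprime_iff_coprime.mpr (hcop t1 ht).1.symm).dvd_of_dvd_mul_left h4
    rw [← Int.natCast_modEq_iff]
    push_cast
    exact (Int.modEq_iff_dvd).mpr h5
  · rintro ⟨x1, x2⟩ hx ⟨y1, y2⟩ hy h
    simp only [coe_filter, mem_product, Set.mem_ofPred_eq, mem_filter] at hx hy h
    obtain ⟨⟨⟨-, hx2⟩, hx3⟩, rfl⟩ := hx
    obtain ⟨⟨⟨-, hy2⟩, hy3⟩, rfl⟩ := hy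
    have h1 : x2.1 = y2.1 := by rw [hp _ hx2, hp _ hy2, h]
    have h2 : x2.2.2 = y2.2.2 := hx3.symm.trans hy3
    have h3 : x2.2.1 = y2.2.1 := by
      have e1 := rel _ hx2
      have e2 := rel _ hy2
      rw [h1, h2] at e1
      have : τ * x2.2.1 = τ * y2.2.1 := by linarith
      exact_mod_cast hτ.mul_left_cancel this
    exact Prod.ext rfl (Prod.ext h1 (Prod.ext h3 h2))

theorem Finset.card_pairs_le_of_pow {T : Finset (ℕ × ℕ × ℕ)} {e g X d : ℕ} {σ τ : ℤ}
    {A : ℕ → ℕ} (hσ : IsUnit σ) (hτ : IsUnit τ) (he : e ≠ 0)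
    (rel : ∀ t ∈ T, (t.2.2 : ℤ) = σ * t.1 + τ * t.2.1)
    (hp : ∀ t ∈ T, t.1 = e * A t.1 ^ g) (hg : 2 ≤ g) (hX : ∀ t ∈ T, t.1 ≤ X)
    (hd : ∀ n, n ≠ 0 → n ≤ X → #n.divisors ≤ d) :
    #{x ∈ T ×ˢ T | x.1.2.2 = x.2.2.2} ≤ #T + 2 * d * #(T.image (·.2.1)) ^ 2 := by
  set P := {x ∈ T ×ˢ T | x.1.2.2 = x.2.2.2}
  have hP : ∀ x ∈ P, x.1 ∈ T ∧ x.2 ∈ T ∧ x.1.2.2 = x.2.2.2 := fun x hx => by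
    simpa only [P, mem_filter, mem_product, and_assoc] using hx
  have h_one : ∀ u : ℕ × ℕ, ∀ S ⊆ P, (∀ x ∈ S, (x.1.2.1, x.2.2.1) = u) →
      (∀ x ∈ S, x.2.1 < x.1.1) → #S ≤ d := by
    intro u S hSP hu hlt
    rcases S.eq_empty_or_nonempty with rfl | ⟨y, hy⟩
    · simp
    obtain ⟨hy1, hy2, hy3⟩ := hP y (hSP hy)
    have hylt : A y.2.1 ^ g < A y.1.1 ^ g := by
      have := hlt y hy
      rw [hp _ hy1, hp _ hy2] at this
      exact lt_of_mul_lt_mul_left this (Nat.zero_le e)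
    obtain ⟨m, hm⟩ := Nat.exists_eq_add_of_le hylt.le
    have hm0 : m ≠ 0 := by lia
    have hmX : m ≤ X := by
      refine le_trans ?_ (hX _ hy1)
      rw [hp _ hy1, hm]
      calc m ≤ 1 * (A y.2.1 ^ g + m) := by lia
        _ ≤ _ := Nat.mul_le_mul_right _ (by lia)
    refine le_trans ?_ (hd m hm0 hmX)
    rw [← card_image_of_injOn (f := fun x => (A x.1.1, A x.2.1))]
    · refine Nat.card_pow_sub_pow_eq_le hg hm0 fun z hz => ?_
      obtain ⟨x, hx, rfl⟩ := mem_image.mp hz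
      obtain ⟨hx1, hx2, hx3⟩ := hP x (hSP hx)
      have hxy : (x.1.2.1, x.2.2.1) = (y.1.2.1, y.2.2.1) := (hu x hx).trans (hu y hy).symm
      obtain ⟨hq1, hq2⟩ := Prod.mk.inj hxy
      have e1 := rel _ hx1
      have e2 := rel _ hx2
      have e3 := rel _ hy1
      have e4 := rel _ hy2
      rw [hx3] at e1
      rw [hy3] at e3
      rw [hq1] at e1
      rw [hq2] at e2
      have h1 : σ * ((x.1.1 : ℤ) - x.2.1) = σ * ((y.1.1 : ℤ) - y.2.1) := by linarith
      have h2 := hσ.mul_left_cancel h1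
      have h3 : x.1.1 + y.2.1 = x.2.1 + y.1.1 := by lia
      rw [hp _ hx1, hp _ hx2, hp _ hy1, hp _ hy2, ← mul_add, ← mul_add] at h3
      have h4 := Nat.eq_of_mul_eq_mul_left (Nat.pos_of_ne_zero he) h3
      simp only
      lia
    · intro x hx z hz h
      obtain ⟨hx1, hx2, -⟩ := hP x (hSP hx)
      obtain ⟨hz1, hz2, -⟩ := hP z (hSP hz)
      obtain ⟨h1, h2⟩ := Prod.mk.inj h
      obtain ⟨hq1, hq2⟩ := Prod.mk.inj ((hu x hx).trans (hu z hz).symm)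
      have p1 : x.1.1 = z.1.1 := by rw [hp _ hx1, hp _ hz1, h1]
      have p2 : x.2.1 = z.2.1 := by rw [hp _ hx2, hp _ hz2, h2]
      have r1 : x.1.2.2 = z.1.2.2 := by
        have e1 := rel _ hx1
        have e2 := rel _ hz1
        rw [p1, hq1, ← e2] at e1
        exact_mod_cast e1
      have r2 : x.2.2.2 = z.2.2.2 := by
        have e1 := rel _ hx2
        have e2 := rel _ hz2
        rw [p2, hq2, ← e2] at e1
        exact_mod_cast e1
      exact Prod.ext (Prod.ext p1 (Prod.ext hq1 r1)) (Prod.ext p2 (Prod.ext hq2 r2))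
  have h_diag : #{x ∈ P | x.1 = x.2} ≤ #T := by
    refine card_le_card_of_injOn Prod.fst (fun x hx => (hP x (mem_filter.mp hx).1).1) ?_
    intro x hx y hy h
    have h1 := (mem_filter.mp hx).2
    have h2 := (mem_filter.mp hy).2
    exact Prod.ext h (h1.symm.trans (h.trans h2))
  have h_half : ∀ S ⊆ P, (∀ x ∈ S, x.2.1 < x.1.1) → #S ≤ d * #(T.image (·.2.1)) ^ 2 := by
    intro S hSP hlt
    rw [sq, ← card_product]
    refine card_le_mul_card_image_of_maps_to (f := fun x => (x.1.2.1, x.2.2.1)) ?_ _ ?_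
    · intro x hx
      obtain ⟨hx1, hx2, -⟩ := hP x (hSP hx)
      exact mem_product.mpr ⟨mem_image_of_mem _ hx1, mem_image_of_mem _ hx2⟩
    · intro u _
      exact h_one u _ ((filter_subset _ _).trans hSP) (fun x hx => (mem_filter.mp hx).2)
        (fun x hx => hlt x (mem_filter.mp hx).1)
  have h_gt := h_half {x ∈ P | x.2.1 < x.1.1} (filter_subset _ _) (fun x hx => (mem_filter.mp hx).2)
  have h_lt : #{x ∈ P | x.1.1 < x.2.1} ≤ d * #(T.image (·.2.1)) ^ 2 := by
    rw [← card_image_of_injective _ Prod.swap_injective]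
    refine h_half _ ?_ ?_ <;> intro x hx <;> obtain ⟨y, hy, rfl⟩ := mem_image.mp hx
    · obtain ⟨h1, h2, h3⟩ := hP y (mem_filter.mp hy).1
      exact mem_filter.mpr ⟨mem_product.mpr ⟨h2, h1⟩, h3.symm⟩
    · exact (mem_filter.mp hy).2
  have h_cover : P ⊆ {x ∈ P | x.1 = x.2} ∪ {x ∈ P | x.2.1 < x.1.1} ∪ {x ∈ P | x.1.1 < x.2.1} := by
    intro x hx
    simp only [mem_union, mem_filter, hx, true_and]
    obtain ⟨h1, h2, h3⟩ := hP x hx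
    rcases lt_trichotomy x.1.1 x.2.1 with h | h | h
    · exact .inr h
    · refine .inl (.inl (Prod.ext h (Prod.ext ?_ h3)))
      have e1 := rel _ h1
      rw [h, h3, rel _ h2, add_left_cancel_iff] at e1
      exact_mod_cast (hτ.mul_left_cancel e1).symm
    · exact .inl (.inr h)
  have := (card_le_card h_cover).trans
    ((card_union_le _ _).trans (Nat.add_le_add_right (card_union_le _ _) _))
  lia

/-- The sizes, on a dyadic scale, of the factors of `n`: at the place `i ≤ 5` that of
`exactPart i n`, then those of the radical of `tailPart n` and of `tailPart n`. -/
def boxKey (n : ℕ) : ℕ → ℕ := fun i =>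
  if i ∈ Icc 1 5 then Nat.log 2 (exactPart i n)
  else if i = 6 then Nat.log 2 (rad (tailPart n))
  else if i = 7 then Nat.log 2 (tailPart n) else 0

/-- `S` consists of positive integers up to `X` with the same dyadic sizes `κ`. -/
def IsBox (X : ℕ) (κ : ℕ → ℕ) (S : Finset ℕ) : Prop :=
  ∀ n ∈ S, n ≠ 0 ∧ n ≤ X ∧ boxKey n = κ

/-- The cofactor in `n` of the product of the parts with exponents in `I`. -/
def cofactor (I : Finset ℕ) (n : ℕ) : ℕ := (∏ i ∈ Icc 1 5 \ I, exactPart i n ^ i) * tailPart n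

theorem cofactor_pos (I : Finset ℕ) (n : ℕ) : 0 < cofactor I n :=
  Nat.mul_pos (prod_pos fun _ _ => pow_pos (exactPart_pos _ _) _) (tailPart_pos n)

theorem cofactor_mul_prod {I : Finset ℕ} (hI : I ⊆ Icc 1 5) {n : ℕ} (hn : n ≠ 0) :
    cofactor I n * ∏ i ∈ I, exactPart i n ^ i = n := by
  conv_rhs => rw [← prod_exactPart_pow_mul_tailPart hn, ← prod_sdiff hI]
  rw [cofactor]
  ring

theorem two_pow_boxKey_le {i n : ℕ} (hi : i ∈ Icc 1 5) : 2 ^ boxKey n i ≤ exactPart i n := by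
  rw [boxKey, if_pos hi]
  exact Nat.pow_log_le_self 2 (exactPart_pos i n).ne'

theorem exactPart_lt {i n : ℕ} (hi : i ∈ Icc 1 5) : exactPart i n < 2 ^ (boxKey n i + 1) := by
  rw [boxKey, if_pos hi]
  exact Nat.lt_pow_succ_log_self (by norm_num) _

theorem boxKey_six (n : ℕ) : boxKey n 6 = Nat.log 2 (rad (tailPart n)) := by simp [boxKey]

theorem boxKey_seven (n : ℕ) : boxKey n 7 = Nat.log 2 (tailPart n) := by simp [boxKey]

theorem two_pow_boxKey_seven_le (n : ℕ) : 2 ^ boxKey n 7 ≤ tailPart n := by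
  rw [boxKey_seven]
  exact Nat.pow_log_le_self 2 (tailPart_pos n).ne'

theorem two_pow_sum_le_prod_exactPart {I : Finset ℕ} (hI : I ⊆ Icc 1 5) (w : ℕ → ℕ) (n : ℕ) :
    2 ^ (∑ i ∈ I, w i * boxKey n i) ≤ ∏ i ∈ I, exactPart i n ^ w i := by
  rw [← prod_pow_eq_pow_sum]
  refine prod_le_prod' fun i hi => ?_
  rw [mul_comm, pow_mul]
  exact Nat.pow_le_pow_left (two_pow_boxKey_le (hI hi)) _

theorem prod_exactPart_le_two_pow_sum {I : Finset ℕ} (hI : I ⊆ Icc 1 5) (w : ℕ → ℕ) (n : ℕ) :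
    ∏ i ∈ I, exactPart i n ^ w i ≤ 2 ^ (∑ i ∈ I, w i * (boxKey n i + 1)) := by
  rw [← prod_pow_eq_pow_sum]
  refine prod_le_prod' fun i hi => ?_
  rw [mul_comm, pow_mul]
  exact Nat.pow_le_pow_left (exactPart_lt (hI hi)).le _

theorem two_pow_le_cofactor (I : Finset ℕ) (n : ℕ) :
    2 ^ (∑ i ∈ Icc 1 5 \ I, i * boxKey n i + boxKey n 7) ≤ cofactor I n := by
  rw [pow_add]
  exact Nat.mul_le_mul (two_pow_sum_le_prod_exactPart sdiff_subset id n)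
    (two_pow_boxKey_seven_le n)

theorem lt_two_pow_boxKey {n : ℕ} (hn : n ≠ 0) :
    n < 2 ^ (∑ i ∈ Icc 1 5, i * boxKey n i + boxKey n 7 + 16) := by
  have h1 := prod_exactPart_le_two_pow_sum (subset_refl (Icc 1 5)) id n
  have h2 : tailPart n < 2 ^ (boxKey n 7 + 1) := by
    rw [boxKey_seven]
    exact Nat.lt_pow_succ_log_self (by norm_num) _
  have h3 : ∑ i ∈ Icc 1 5, i * boxKey n i + boxKey n 7 + 16 =
      ∑ i ∈ Icc 1 5, id i * (boxKey n i + 1) + (boxKey n 7 + 1) := by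
    simp only [mul_add, sum_add_distrib, id, mul_one]
    have : ∑ i ∈ Icc 1 5, i = 15 := by decide
    rw [this]
    ring
  conv_lhs => rw [← prod_exactPart_pow_mul_tailPart hn]
  rw [h3, pow_add]
  exact Nat.mul_lt_mul_of_le_of_lt h1 h2 (by positivity)

theorem two_pow_le_rad (n : ℕ) : 2 ^ (∑ i ∈ Icc 1 6, boxKey n i) ≤ rad n := by
  rw [rad_eq_prod_exactPart_mul, sum_Icc_succ_top (by norm_num), pow_add]
  refine Nat.mul_le_mul ?_ ?_
  · simpa using two_pow_sum_le_prod_exactPart (subset_refl (Icc 1 5)) (fun _ => 1) n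
  · rw [boxKey_six]
    exact Nat.pow_log_le_self 2 (rad_pos _).ne'

theorem six_mul_boxKey_six_le (n : ℕ) : 6 * boxKey n 6 ≤ boxKey n 7 := by
  rw [boxKey_seven, boxKey_six]
  refine Nat.le_log_of_pow_le (by norm_num) ?_
  rw [mul_comm, pow_mul]
  exact (Nat.pow_le_pow_left (Nat.pow_log_le_self 2 (rad_pos _).ne') 6).trans
    (rad_tailPart_pow_le n)

theorem card_image_prod_le {ι : Type*} (S : Finset ι) (I : Finset ℕ) (F : ℕ → ι → ℕ) (M : ℕ → ℕ)
    (h : ∀ i ∈ I, #(S.image (F i)) ≤ M i) : #(S.image fun n => ∏ i ∈ I, F i n) ≤ ∏ i ∈ I, M i := by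
  induction I using Finset.induction_on with
  | empty =>
    simp only [prod_empty]
    exact card_le_one.mpr (by simp)
  | insert a I ha ih =>
    simp only [prod_insert ha]
    refine le_trans ?_ (Nat.mul_le_mul (h a (mem_insert_self a I))
      (ih fun i hi => h i (mem_insert_of_mem hi)))
    rw [← card_product]
    refine le_trans (card_le_card ?_) (card_image_le (f := fun z : ℕ × ℕ => z.1 * z.2))
    intro x hx
    obtain ⟨n, hn, rfl⟩ := mem_image.mp hx
    exact mem_image.mpr ⟨(F a n, ∏ i ∈ I, F i n),
      mem_product.mpr ⟨mem_image_of_mem _ hn, mem_image_of_mem _ hn⟩, rfl⟩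

theorem IsBox.card_image_prod_exactPart_le {X : ℕ} {κ : ℕ → ℕ} {S : Finset ℕ} (hS : IsBox X κ S)
    {I : Finset ℕ} (hI : I ⊆ Icc 1 5) (w : ℕ → ℕ) :
    (#(S.image fun n => ∏ i ∈ I, exactPart i n ^ w i) : ℝ) ≤ 2 ^ (∑ i ∈ I, (κ i : ℝ) + 5) := by
  have h1 : #(S.image fun n => ∏ i ∈ I, exactPart i n ^ w i) ≤ ∏ i ∈ I, 2 ^ (κ i + 1) := by
    refine card_image_prod_le S I _ _ fun i hi => ?_
    have h2 : S.image (fun n => exactPart i n ^ w i) ⊆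
        (range (2 ^ (κ i + 1))).image (· ^ w i) := by
      intro x hx
      obtain ⟨n, hn, rfl⟩ := mem_image.mp hx
      refine mem_image.mpr ⟨exactPart i n, mem_range.mpr ?_, rfl⟩
      rw [← (hS n hn).2.2]
      exact exactPart_lt (hI hi)
    exact ((card_le_card h2).trans card_image_le).trans (card_range _).le
  have h3 : #I ≤ 5 := (card_le_card hI).trans (by simp)
  have h4 : #(S.image fun n => ∏ i ∈ I, exactPart i n ^ w i) ≤ 2 ^ (∑ i ∈ I, κ i + 5) := by
    refine h1.trans ?_
    rw [prod_pow_eq_pow_sum]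
    refine Nat.pow_le_pow_right (by norm_num) ?_
    simp only [sum_add_distrib, sum_const, smul_eq_mul, mul_one]
    lia
  calc _ ≤ ((2 ^ (∑ i ∈ I, κ i + 5) : ℕ) : ℝ) := by exact_mod_cast h4
    _ = _ := by
      rw [Nat.cast_pow, ← Real.rpow_natCast]
      push_cast
      rfl

theorem IsBox.card_image_cofactor_le {X : ℕ} {κ : ℕ → ℕ} {S : Finset ℕ} {d : ℝ}
    (hS : IsBox X κ S) (hd : ∀ m, (#{n ∈ Icc 1 X | rad n = m} : ℝ) ≤ 2 ^ d) (I : Finset ℕ) :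
    (#(S.image (cofactor I)) : ℝ) ≤ 2 ^ (∑ i ∈ Icc 1 5 \ I, (κ i : ℝ) + κ 6 + 6 + d) := by
  have h1 := hS.card_image_prod_exactPart_le (I := Icc 1 5 \ I) sdiff_subset id
  have h2 : (#(S.image tailPart) : ℝ) ≤ 2 ^ (κ 6 + 1 + d) := by
    have h3 : ∀ m ∈ range (2 ^ (κ 6 + 1)),
        #{x ∈ S.image tailPart | rad x = m} ≤ ⌊(2 : ℝ) ^ d⌋₊ := by
      intro m _
      refine le_trans (card_le_card ?_) (Nat.le_floor (hd m))
      refine filter_subset_filter _ fun x hx => ?_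
      obtain ⟨n, hn, rfl⟩ := mem_image.mp hx
      obtain ⟨hn0, hnX, -⟩ := hS n hn
      exact mem_Icc.mpr ⟨tailPart_pos n, (Nat.le_of_dvd (by lia)
        (Dvd.intro_left _ (prod_exactPart_pow_mul_tailPart hn0))).trans hnX⟩
    have h4 := card_le_mul_card_image_of_maps_to (f := rad) (s := S.image tailPart) (fun x hx => by
      obtain ⟨n, hn, rfl⟩ := mem_image.mp hx
      rw [mem_range, ← (hS n hn).2.2, boxKey_six]
      exact Nat.lt_pow_succ_log_self (by norm_num) _) _ h3
    rw [card_range] at h4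
    calc (#(S.image tailPart) : ℝ) ≤ (⌊(2 : ℝ) ^ d⌋₊ * 2 ^ (κ 6 + 1) : ℕ) := by exact_mod_cast h4
      _ ≤ 2 ^ d * 2 ^ (κ 6 + 1) := by
        push_cast
        gcongr
        exact Nat.floor_le (by positivity)
      _ = _ := by
        rw [← Real.rpow_natCast, ← Real.rpow_add (by norm_num)]
        congr 1
        push_cast
        ring
  have h5 : #(S.image (cofactor I)) ≤
      #(S.image fun n => ∏ i ∈ Icc 1 5 \ I, exactPart i n ^ id i) * #(S.image tailPart) := by
    rw [← card_product]
    refine le_trans (card_le_card ?_) (card_image_le (f := fun z : ℕ × ℕ => z.1 * z.2))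
    intro x hx
    obtain ⟨n, hn, rfl⟩ := mem_image.mp hx
    exact mem_image.mpr ⟨(_, _),
      mem_product.mpr ⟨mem_image_of_mem _ hn, mem_image_of_mem _ hn⟩, rfl⟩
  calc (#(S.image (cofactor I)) : ℝ) ≤
        (#(S.image fun n => ∏ i ∈ Icc 1 5 \ I, exactPart i n ^ id i) *
          #(S.image tailPart) : ℕ) := by
        exact_mod_cast h5
    _ ≤ 2 ^ (∑ i ∈ Icc 1 5 \ I, (κ i : ℝ) + 5) * 2 ^ (κ 6 + 1 + d) := by
      push_cast
      gcongr
    _ = _ := by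
      rw [← Real.rpow_add (by norm_num)]
      congr 1
      ring

theorem IsBox.card_le {X : ℕ} {κ : ℕ → ℕ} {S : Finset ℕ} {d : ℝ}
    (hS : IsBox X κ S) (hd : ∀ m, (#{n ∈ Icc 1 X | rad n = m} : ℝ) ≤ 2 ^ d) :
    (#S : ℝ) ≤ 2 ^ (∑ i ∈ Icc 1 5, (κ i : ℝ) + κ 6 + 6 + d) := by
  have h := hS.card_image_cofactor_le hd ∅
  rw [card_image_of_injOn, sdiff_empty] at h
  · exact h
  · intro x hx y hy hxy
    have h1 := cofactor_mul_prod (empty_subset _) (hS x hx).1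
    have h2 := cofactor_mul_prod (empty_subset _) (hS y hy).1
    rw [prod_empty, mul_one] at h1 h2
    rw [← h1, ← h2, hxy]

/-- Upper bounds for the count `2 ^ N`, on a logarithmic scale, that come from the pair of exponent
vectors `p`, `q`; here `r` is the total exponent of the third vector. -/
structure PairBounds (p q : ℕ → ℝ) (r N h : ℝ) : Prop where
  congr_bound : ∀ (g : ℕ) (I J : Finset ℕ), 0 < g → I ⊆ Icc 1 5 → J ⊆ Icc 1 5 →
    (∀ i ∈ I, g ∣ i) →
    2 * N ≤ 2 * (p 1 + p 2 + p 3 + p 4 + p 5 + p 6) + 2 * (q 1 + q 2 + q 3 + q 4 + q 5 + q 6) + r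
        - (∑ i ∈ I, p i + ∑ j ∈ J, q j) + h ∨
    2 * N ≤ 2 * (p 1 + p 2 + p 3 + p 4 + p 5 + p 6) + 2 * (q 1 + q 2 + q 3 + q 4 + q 5 + q 6) + r
        - (∑ i ∈ I, p i + ∑ j ∈ J, q j)
        + (∑ i ∈ I, ((i / g : ℕ) : ℝ) * p i + ∑ j ∈ J, (j : ℝ) * q j
          - (q 1 + 2 * q 2 + 3 * q 3 + 4 * q 4 + 5 * q 5 + q 7)) + h
  power_bound : ∀ (g k : ℕ) (I J : Finset ℕ), 2 ≤ g → 2 ≤ k → I ⊆ Icc 1 5 → J ⊆ Icc 1 5 →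
    (∀ i ∈ I, g ∣ i) → (∀ j ∈ J, k ∣ j) →
    2 * N ≤ 2 * (p 1 + p 2 + p 3 + p 4 + p 5 + p 6) + 2 * (q 1 + q 2 + q 3 + q 4 + q 5 + q 6) + r
        - (∑ i ∈ I, p i + ∑ j ∈ J, q j) + h

set_option maxHeartbeats 2000000 in
/-- The linear program behind the exponent: the available bounds force `N ≤ 0.6588 * S`, up to a
multiple of the error `h`. -/
theorem PairBounds.le_of_linear_program {p q : ℕ → ℝ} {r N S h : ℝ} (h_err : 0 ≤ h)
    (hp : ∀ i, 0 ≤ p i) (hq : ∀ i, 0 ≤ q i) (wp : 6 * p 6 ≤ p 7) (wq : 6 * q 6 ≤ q 7)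
    (sp : p 1 + 2 * p 2 + 3 * p 3 + 4 * p 4 + 5 * p 5 + p 7 ≤ S + h)
    (sq : q 1 + 2 * q 2 + 3 * q 3 + 4 * q 4 + 5 * q 5 + q 7 ≤ S + h)
    (sq' : S ≤ q 1 + 2 * q 2 + 3 * q 3 + 4 * q 4 + 5 * q 5 + q 7 + h)
    (tot : (p 1 + p 2 + p 3 + p 4 + p 5 + p 6) + (q 1 + q 2 + q 3 + q 4 + q 5 + q 6) + r ≤ S + h)
    (tpq : N ≤ (p 1 + p 2 + p 3 + p 4 + p 5 + p 6) + (q 1 + q 2 + q 3 + q 4 + q 5 + q 6) + h)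
    (tp : N ≤ (p 1 + p 2 + p 3 + p 4 + p 5 + p 6) + r + h)
    (tq : N ≤ (q 1 + q 2 + q 3 + q 4 + q 5 + q 6) + r + h)
    (lin : 3 * (p 1 + q 1) ≤ 2 * ((p 1 + p 2 + p 3 + p 4 + p 5 + p 6) +
      (q 1 + q 2 + q 3 + q 4 + q 5 + q 6) + r - N) + h)
    (hpq : PairBounds p q r N h) (hqp : PairBounds q p r N h) :
    N ≤ 0.6588 * S + 10000 * h := by
  by_contra hN
  rw [not_le] at hN
  norm_num at hN
  have p1 := hp 1
  have p2 := hp 2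
  have p3 := hp 3
  have p4 := hp 4
  have p5 := hp 5
  have p6 := hp 6
  have q1 := hq 1
  have q2 := hq 2
  have q3 := hq 3
  have q4 := hq 4
  have q5 := hq 5
  have q6 := hq 6
  have h1 := hpq.power_bound 2 2 {2} {2, 4} (by decide) (by decide) (by decide) (by decide) (by
      decide) (by decide)
  norm_num at h1
  have h2 := hqp.power_bound 2 3 {2} {3} (by decide) (by decide) (by decide) (by decide) (by
      decide) (by decide)
  norm_num at h2
  have h3 := hpq.congr_bound 1 {1, 2} {1, 2} (by decide) (by decide) (by decide) (by decide)
  norm_num at h3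
  replace h3 := h3.resolve_right (fun pen => by linarith only [hN, h_err, sq', wp, wq, p1, p2, p3,
      p4, p5, p6, q1, q2, q3, q4, q5, q6, tot, tq, tp, pen, h1])
  have h4 := hqp.congr_bound 3 {3} {1} (by decide) (by decide) (by decide) (by decide)
  norm_num at h4
  replace h4 := h4.resolve_right (fun pen => by linarith only [hN, h_err, sq', wp, wq, p1, p2, p3,
      p4, p5, p6, q1, q2, q3, q4, q5, q6, lin, sq, tot, tpq, pen, h3])
  have h5 := hpq.congr_bound 1 {1, 2, 3, 4} {1, 2} (by decide) (by decide) (by decide) (by decide)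
  norm_num at h5
  rcases h5 with h5 | h5
  · have h6 := hpq.power_bound 2 3 {2} {3} (by decide) (by decide) (by decide) (by decide) (by
        decide) (by decide)
    norm_num at h6
    have h7 := hqp.congr_bound 3 {3} {1, 2} (by decide) (by decide) (by decide) (by decide)
    norm_num at h7
    replace h7 := h7.resolve_right (fun pen => by linarith only [hN, h_err, sq', wp, wq, p1, p2,
        p3, p4, p5, p6, q1, q2, q3, q4, q5, q6, sq, tot, tq, tp, pen, h3, h4, h5, h6])
    have h8 := hqp.congr_bound 2 {2, 4} {1, 2} (by decide) (by decide) (by decide) (by decide)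
    norm_num at h8
    replace h8 := h8.resolve_right (fun pen => by linarith only [hN, h_err, sq', wp, wq, p1, p2,
        p3, p4, p5, p6, q1, q2, q3, q4, q5, q6, sq, tot, tpq, pen, h3, h5, h7])
    have h9 := hpq.congr_bound 1 {1, 4} {1, 2, 3} (by decide) (by decide) (by decide) (by decide)
    norm_num at h9
    rcases h9 with h9 | h9
    · have h10 := hpq.congr_bound 1 {1, 3, 4} {2, 3, 5} (by decide) (by decide) (by decide) (by
          decide)
      norm_num at h10
      rcases h10 with h10 | h10
      · have h11 := hqp.congr_bound 3 {3} {1, 2, 3} (by decide) (by decide) (by decide) (by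
            decide)
        norm_num at h11
        replace h11 := h11.resolve_right (fun pen => by linarith only [hN, h_err, sq', wp, wq, p1,
            p2, p3, p4, p5, p6, q1, q2, q3, q4, q5, q6, sq, tot, tq, tp, pen, h5, h7, h10])
        have h12 := hqp.congr_bound 1 {1, 2, 3} {1, 2, 3} (by decide) (by decide) (by decide) (by
            decide)
        norm_num at h12
        replace h12 := h12.resolve_right (fun pen => by linarith only [hN, h_err, sq', wp, wq, p1,
            p2, p3, p4, p5, p6, q1, q2, q3, q4, q5, q6, sp, sq, tot, tp, tpq, pen, h5, h8, h10,
            h11])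
        have h13 := hqp.congr_bound 2 {2, 4} {1, 3, 4} (by decide) (by decide) (by decide) (by
            decide)
        norm_num at h13
        replace h13 := h13.resolve_right (fun pen => by linarith only [hN, h_err, sq', wp, wq, p1,
            p2, p3, p4, p5, p6, q1, q2, q3, q4, q5, q6, sq, tot, pen, h5, h10])
        have h14 := hpq.congr_bound 1 {1} {1, 2, 4} (by decide) (by decide) (by decide) (by
            decide)
        norm_num at h14
        replace h14 := h14.resolve_right (fun pen => by linarith only [hN, h_err, sq', wp, wq, p1,
            p2, p3, p4, p5, p6, q1, q2, q3, q4, q5, q6, sp, sq, tot, tp, tpq, pen, h8, h12, h13])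
        have h15 := hqp.congr_bound 2 {2, 4} {1, 2, 4} (by decide) (by decide) (by decide) (by
            decide)
        norm_num at h15
        replace h15 := h15.resolve_right (fun pen => by linarith only [hN, h_err, sq', wp, wq, p1,
            p2, p3, p4, p5, p6, q1, q2, q3, q4, q5, q6, sp, sq, tot, tq, tpq, pen, h5, h9, h12])
        have h16 := hqp.congr_bound 1 {1, 2, 3} {1, 2, 4} (by decide) (by decide) (by decide) (by
            decide)
        norm_num at h16
        replace h16 := h16.resolve_right (fun pen => by linarith only [hN, h_err, sq', wp, wq, p1,
            p2, p3, p4, p5, p6, q1, q2, q3, q4, q5, q6, sp, sq, tot, tp, tpq, pen, h5, h9, h12,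
            h15])
        have h17 := hpq.congr_bound 5 {5} {1, 2, 3, 4} (by decide) (by decide) (by decide) (by
            decide)
        norm_num at h17
        replace h17 := h17.resolve_right (fun pen => by linarith only [hN, h_err, sq', wp, wq, p1,
            p2, p3, p4, p5, p6, q1, q2, q3, q4, q5, q6, sp, sq, tot, tp, tpq, pen, h12, h14, h15,
            h16])
        have h18 := hqp.congr_bound 1 {1, 4} {1, 2} (by decide) (by decide) (by decide) (by
            decide)
        norm_num at h18
        replace h18 := h18.resolve_right (fun pen => by linarith only [hN, h_err, sq', wp, wq, p1,
            p2, p3, p4, p5, p6, q1, q2, q3, q4, q5, q6, sp, sq, tot, tq, tp, pen, h5, h12, h14,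
            h15, h17])
        have h19 := hpq.congr_bound 1 {1, 2} {1, 2, 5} (by decide) (by decide) (by decide) (by
            decide)
        norm_num at h19
        replace h19 := h19.resolve_right (fun pen => by linarith only [hN, h_err, sq', wp, wq, p1,
            p2, p3, p4, p5, p6, q1, q2, q3, q4, q5, q6, lin, sp, sq, tot, tq, tpq, pen, h3, h12,
            h16, h18])
        have h20 := hpq.congr_bound 1 {1, 3, 4} {1, 3, 4} (by decide) (by decide) (by decide) (by
            decide)
        norm_num at h20
        replace h20 := h20.resolve_right (fun pen => by linarith only [hN, h_err, sq', wp, wq, p1,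
            p2, p3, p4, p5, p6, q1, q2, q3, q4, q5, q6, lin, sp, sq, tot, tq, pen, h5, h10, h12,
            h16, h17, h18])
        linarith only [hN, h_err, sq', wp, wq, p1, p2, p3, p4, p5, p6, q1, q2, q3, q4, q5, q6, sp,
            sq, tot, tq, tpq, h5, h12, h14, h15, h16, h17, h18, h19, h20]
      · have h21 := hpq.congr_bound 1 {1, 3} {3, 5} (by decide) (by decide) (by decide) (by
            decide)
        norm_num at h21
        rcases h21 with h21 | h21
        · have h22 := hqp.congr_bound 3 {3} {1, 2, 3} (by decide) (by decide) (by decide) (by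
              decide)
          norm_num at h22
          replace h22 := h22.resolve_right (fun pen => by linarith only [hN, h_err, sq', wp, wq,
              p1, p2, p3, p4, p5, p6, q1, q2, q3, q4, q5, q6, sq, tot, tq, tp, pen, h5, h6, h21])
          have h23 := hpq.congr_bound 1 {1, 2, 3} {1, 2, 3} (by decide) (by decide) (by decide)
              (by decide)
          norm_num at h23
          replace h23 := h23.resolve_right (fun pen => by linarith only [hN, h_err, sq', wp, wq,
              p1, p2, p3, p4, p5, p6, q1, q2, q3, q4, q5, q6, sp, sq, tot, tp, pen, h5, h10, h21,
              h22])
          have h24 := hpq.congr_bound 1 {1, 2, 3} {1, 3, 5} (by decide) (by decide) (by decide)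
              (by decide)
          norm_num at h24
          replace h24 := h24.resolve_right (fun pen => by linarith only [hN, h_err, sq', wp, wq,
              p1, p2, p3, p4, p5, p6, q1, q2, q3, q4, q5, q6, lin, sp, sq, tot, tq, tpq, pen, h5,
              h10, h23])
          linarith only [hN, h_err, sq', wp, wq, p1, p2, p3, p4, p5, p6, q1, q2, q3, q4, q5, q6,
              sp, sq, tot, tq, tpq, h5, h9, h10, h23, h24]
        · have h25 := hpq.congr_bound 3 {3} {1, 2, 3} (by decide) (by decide) (by decide) (by
              decide)
          norm_num at h25
          rcases h25 with h25 | h25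
          · have h26 := hqp.congr_bound 3 {3} {1, 2, 3} (by decide) (by decide) (by decide) (by
                decide)
            norm_num at h26
            replace h26 := h26.resolve_right (fun pen => by linarith only [hN, h_err, sq', wp, wq,
                p1, p2, p3, p4, p5, p6, q1, q2, q3, q4, q5, q6, sq, tot, tq, tp, pen, h5, h7,
                h25])
            have h27 := hqp.congr_bound 1 {1, 2, 3} {1, 2, 3} (by decide) (by decide) (by decide)
                (by decide)
            norm_num at h27
            replace h27 := h27.resolve_right (fun pen => by linarith only [hN, h_err, sq', wp, wq,
                p1, p2, p3, p4, p5, p6, q1, q2, q3, q4, q5, q6, sp, sq, tot, tp, pen, h5, h9, h21,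
                h25, h26])
            linarith only [hN, h_err, sq', wp, wq, p1, p2, p3, p4, p5, p6, q1, q2, q3, q4, q5, q6,
                lin, sp, sq, tot, tq, tpq, h5, h21, h27]
          · have h28 := hpq.power_bound 3 3 {3} {3} (by decide) (by decide) (by decide) (by
                decide) (by decide) (by decide)
            norm_num at h28
            linarith only [hN, h_err, sq', wp, wq, p1, p2, p3, p4, p5, p6, q1, q2, q3, q4, q5, q6,
                sp, tot, tq, tp, h7, h9, h25, h28]
    · have h29 := hqp.congr_bound 3 {3} {1, 2, 5} (by decide) (by decide) (by decide) (by decide)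
      norm_num at h29
      replace h29 := h29.resolve_right (fun pen => by linarith only [hN, h_err, sq', wp, wq, p1,
          p2, p3, p4, p5, p6, q1, q2, q3, q4, q5, q6, sp, tot, tq, tp, pen, h4, h7, h9])
      have h30 := hqp.congr_bound 2 {2, 4} {1, 2, 4} (by decide) (by decide) (by decide) (by
          decide)
      norm_num at h30
      replace h30 := h30.resolve_right (fun pen => by linarith only [hN, h_err, sq', wp, wq, p1,
          p2, p3, p4, p5, p6, q1, q2, q3, q4, q5, q6, sp, sq, tot, tp, tpq, pen, h5, h29])
      have h31 := hqp.congr_bound 3 {3} {1, 4} (by decide) (by decide) (by decide) (by decide)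
      norm_num at h31
      replace h31 := h31.resolve_right (fun pen => by linarith only [hN, h_err, sq', wp, wq, p1,
          p2, p3, p4, p5, p6, q1, q2, q3, q4, q5, q6, sp, sq, tot, tp, tpq, pen, h4, h5, h29,
          h30])
      have h32 := hpq.power_bound 3 3 {3} {3} (by decide) (by decide) (by decide) (by decide) (by
          decide) (by decide)
      norm_num at h32
      have h33 := hpq.power_bound 2 3 {2, 4} {3} (by decide) (by decide) (by decide) (by decide)
          (by decide) (by decide)
      norm_num at h33
      have h34 := hqp.congr_bound 3 {3} {1, 2, 3, 4} (by decide) (by decide) (by decide) (by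
          decide)
      norm_num at h34
      replace h34 := h34.resolve_right (fun pen => by linarith only [hN, h_err, sq', wp, wq, p1,
          p2, p3, p4, p5, p6, q1, q2, q3, q4, q5, q6, sq, tot, tq, tp, pen, h5, h29, h31, h32,
          h33])
      linarith only [hN, h_err, sq', wp, wq, p1, p2, p3, p4, p5, p6, q1, q2, q3, q4, q5, q6, sp,
          sq, tot, tp, tpq, h5, h9, h29, h30, h31, h34]
  · have h35 := hpq.congr_bound 1 {1, 5} {1, 2, 3} (by decide) (by decide) (by decide) (by decide)
    norm_num at h35
    rcases h35 with h35 | h35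
    · have h36 := hpq.congr_bound 3 {3} {1, 2, 3, 4} (by decide) (by decide) (by decide) (by
          decide)
      norm_num at h36
      rcases h36 with h36 | h36
      · have h37 := hpq.power_bound 2 3 {2, 4} {3} (by decide) (by decide) (by decide) (by decide)
            (by decide) (by decide)
        norm_num at h37
        have h38 := hpq.power_bound 2 2 {2, 4} {2, 4} (by decide) (by decide) (by decide) (by
            decide) (by decide) (by decide)
        norm_num at h38
        have h39 := hqp.congr_bound 2 {2} {1, 2, 3} (by decide) (by decide) (by decide) (by
            decide)
        norm_num at h39
        replace h39 := h39.resolve_right (fun pen => by linarith only [hN, h_err, sq', wp, wq, p1,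
            p2, p3, p4, p5, p6, q1, q2, q3, q4, q5, q6, sq, tot, tq, tp, pen, h3, h5, h36])
        have h40 := hpq.congr_bound 2 {2, 4} {2, 3} (by decide) (by decide) (by decide) (by
            decide)
        norm_num at h40
        replace h40 := h40.resolve_right (fun pen => by linarith only [hN, h_err, sq', wp, wq, p1,
            p2, p3, p4, p5, p6, q1, q2, q3, q4, q5, q6, sp, sq, tot, tq, tp, pen, h35, h36, h37])
        have h41 := hpq.congr_bound 1 {1, 3} {1, 2, 3} (by decide) (by decide) (by decide) (by
            decide)
        norm_num at h41
        replace h41 := h41.resolve_right (fun pen => by linarith only [hN, h_err, sq', wp, wq, p1,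
            p2, p3, p4, p5, p6, q1, q2, q3, q4, q5, q6, sp, sq, tot, tq, tp, pen, h5, h35, h36,
            h37, h40])
        have h42 := hpq.congr_bound 1 {1, 3, 5} {1, 2} (by decide) (by decide) (by decide) (by
            decide)
        norm_num at h42
        replace h42 := h42.resolve_right (fun pen => by linarith only [hN, h_err, sq', wp, wq, p1,
            p2, p3, p4, p5, p6, q1, q2, q3, q4, q5, q6, sp, sq, tot, tq, tp, pen, h5, h36, h39,
            h41])
        have h43 := hqp.congr_bound 1 {1, 2} {1, 2, 3, 5} (by decide) (by decide) (by decide) (by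
            decide)
        norm_num at h43
        replace h43 := h43.resolve_right (fun pen => by linarith only [hN, h_err, sq', wp, wq, p1,
            p2, p3, p4, p5, p6, q1, q2, q3, q4, q5, q6, sp, sq, tot, tq, tp, pen, h5, h36, h39,
            h41, h42])
        have h44 := hpq.congr_bound 2 {2, 4} {1, 2, 3} (by decide) (by decide) (by decide) (by
            decide)
        norm_num at h44
        replace h44 := h44.resolve_right (fun pen => by linarith only [hN, h_err, sq', wp, wq, p1,
            p2, p3, p4, p5, p6, q1, q2, q3, q4, q5, q6, sp, sq, tot, tq, tp, pen, h35, h40, h41])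
        have h45 := hpq.congr_bound 4 {4} {1, 2, 4} (by decide) (by decide) (by decide) (by
            decide)
        norm_num at h45
        replace h45 := h45.resolve_right (fun pen => by linarith only [hN, h_err, sq', wp, wq, p1,
            p2, p3, p4, p5, p6, q1, q2, q3, q4, q5, q6, lin, sp, sq, tot, tq, tp, pen, h5, h36,
            h38])
        have h46 := hpq.congr_bound 2 {2, 4} {1, 3, 4} (by decide) (by decide) (by decide) (by
            decide)
        norm_num at h46
        replace h46 := h46.resolve_right (fun pen => by linarith only [hN, h_err, sq', wp, wq, p1,
            p2, p3, p4, p5, p6, q1, q2, q3, q4, q5, q6, sp, sq, tot, tq, pen, h5, h36, h41, h44,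
            h45])
        have h47 := hpq.congr_bound 1 {1, 2, 4} {1, 2} (by decide) (by decide) (by decide) (by
            decide)
        norm_num at h47
        replace h47 := h47.resolve_right (fun pen => by linarith only [hN, h_err, sq', wp, wq, p1,
            p2, p3, p4, p5, p6, q1, q2, q3, q4, q5, q6, sp, sq, tot, tq, pen, h3, h35, h40, h41,
            h44, h45])
        have h48 := hpq.congr_bound 1 {1, 3, 5} {1, 3, 4} (by decide) (by decide) (by decide) (by
            decide)
        norm_num at h48
        replace h48 := h48.resolve_right (fun pen => by linarith only [hN, h_err, sq', wp, wq, p1,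
            p2, p3, p4, p5, p6, q1, q2, q3, q4, q5, q6, sp, sq, tot, tq, pen, h5, h36, h41, h43,
            h44, h46, h47])
        have h49 := hpq.congr_bound 1 {1, 2, 3} {1, 3, 4} (by decide) (by decide) (by decide) (by
            decide)
        norm_num at h49
        replace h49 := h49.resolve_right (fun pen => by linarith only [hN, h_err, sq', wp, wq, p1,
            p2, p3, p4, p5, p6, q1, q2, q3, q4, q5, q6, sp, sq, tot, tq, tp, pen, h5, h36, h43,
            h44, h46, h47, h48])
        linarith only [hN, h_err, sq', wp, wq, p1, p2, p3, p4, p5, p6, q1, q2, q3, q4, q5, q6, sp,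
            sq, tot, tq, tpq, h5, h40, h41, h43, h44, h47, h49]
      · have h50 := hqp.power_bound 2 3 {2, 4} {3} (by decide) (by decide) (by decide) (by decide)
            (by decide) (by decide)
        norm_num at h50
        have h51 := hpq.power_bound 2 2 {2, 4} {2, 4} (by decide) (by decide) (by decide) (by
            decide) (by decide) (by decide)
        norm_num at h51
        have h52 := hqp.congr_bound 2 {2, 4} {1, 2, 3, 5} (by decide) (by decide) (by decide) (by
            decide)
        norm_num at h52
        rcases h52 with h52 | h52
        · have h53 := hqp.power_bound 3 2 {3} {2, 4} (by decide) (by decide) (by decide) (by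
              decide) (by decide) (by decide)
          norm_num at h53
          have h54 := hpq.power_bound 3 3 {3} {3} (by decide) (by decide) (by decide) (by decide)
              (by decide) (by decide)
          norm_num at h54
          have h55 := hqp.congr_bound 3 {3} {1, 2, 3, 5} (by decide) (by decide) (by decide) (by
              decide)
          norm_num at h55
          replace h55 := h55.resolve_right (fun pen => by linarith only [hN, h_err, sq', wp, wq,
              p1, p2, p3, p4, p5, p6, q1, q2, q3, q4, q5, q6, tot, tq, tp, pen, h5, h36, h52, h53,
              h54])
          have h56 := hpq.congr_bound 4 {4} {2, 3} (by decide) (by decide) (by decide) (by decide)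
          norm_num at h56
          replace h56 := h56.resolve_right (fun pen => by linarith only [hN, h_err, sq', wp, wq,
              p1, p2, p3, p4, p5, p6, q1, q2, q3, q4, q5, q6, sp, tot, tq, tp, pen, h35, h36, h53,
              h55])
          have h57 := hpq.congr_bound 2 {2, 4} {1, 2, 3} (by decide) (by decide) (by decide) (by
              decide)
          norm_num at h57
          replace h57 := h57.resolve_right (fun pen => by linarith only [hN, h_err, sq', wp, wq,
              p1, p2, p3, p4, p5, p6, q1, q2, q3, q4, q5, q6, sp, sq, tot, tq, tp, pen, h35, h53,
              h55, h56])
          have h58 := hqp.congr_bound 1 {1, 3} {1, 3} (by decide) (by decide) (by decide) (by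
              decide)
          norm_num at h58
          replace h58 := h58.resolve_right (fun pen => by linarith only [hN, h_err, sq', wp, wq,
              p1, p2, p3, p4, p5, p6, q1, q2, q3, q4, q5, q6, tot, tq, tp, pen, h36, h52, h55])
          have h59 := hqp.congr_bound 4 {4} {1, 4} (by decide) (by decide) (by decide) (by decide)
          norm_num at h59
          replace h59 := h59.resolve_right (fun pen => by linarith only [hN, h_err, sq', wp, wq,
              p1, p2, p3, p4, p5, p6, q1, q2, q3, q4, q5, q6, lin, sq, tot, tq, tp, pen, h5, h36,
              h51, h57])
          have h60 := hqp.congr_bound 1 {1, 3, 5} {1, 2, 3} (by decide) (by decide) (by decide)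
              (by decide)
          norm_num at h60
          replace h60 := h60.resolve_right (fun pen => by linarith only [hN, h_err, sq', wp, wq,
              p1, p2, p3, p4, p5, p6, q1, q2, q3, q4, q5, q6, sp, sq, tot, tq, tp, pen, h5, h36,
              h52, h57, h58])
          have h61 := hqp.congr_bound 2 {2, 4} {1, 4} (by decide) (by decide) (by decide) (by
              decide)
          norm_num at h61
          replace h61 := h61.resolve_right (fun pen => by linarith only [hN, h_err, sq', wp, wq,
              p1, p2, p3, p4, p5, p6, q1, q2, q3, q4, q5, q6, sq, tot, tq, tp, pen, h5, h35, h36,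
              h52, h57, h59])
          linarith only [hN, h_err, sq', wp, wq, p1, p2, p3, p4, p5, p6, q1, q2, q3, q4, q5, q6,
              sp, sq, tot, tq, tp, h5, h36, h52, h57, h60, h61]
        · have h62 := hpq.power_bound 3 3 {3} {3} (by decide) (by decide) (by decide) (by decide)
              (by decide) (by decide)
          norm_num at h62
          have h63 := hpq.congr_bound 3 {3} {1, 2, 3, 5} (by decide) (by decide) (by decide) (by
              decide)
          norm_num at h63
          replace h63 := h63.resolve_right (fun pen => by linarith only [hN, h_err, sq', wp, wq,
              p1, p2, p3, p4, p5, p6, q1, q2, q3, q4, q5, q6, sq, tot, tq, tp, pen, h5, h36, h52,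
              h62])
          have h64 := hqp.congr_bound 4 {4} {2, 3} (by decide) (by decide) (by decide) (by decide)
          norm_num at h64
          replace h64 := h64.resolve_right (fun pen => by linarith only [hN, h_err, sq', wp, wq,
              p1, p2, p3, p4, p5, p6, q1, q2, q3, q4, q5, q6, sq, tot, tq, tp, pen, h5, h36, h50,
              h51, h63])
          linarith only [hN, h_err, sq', wp, wq, p1, p2, p3, p4, p5, p6, q1, q2, q3, q4, q5, q6,
              sq, tot, tq, tp, h5, h36, h50, h51, h52, h63, h64]
    · have h66 := hqp.congr_bound 2 {2, 4} {1, 2, 5} (by decide) (by decide) (by decide) (by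
          decide)
      norm_num at h66
      replace h66 := h66.resolve_right (fun pen => by linarith only [hN, h_err, sq', wp, wq, p1,
          p2, p3, p4, p5, p6, q1, q2, q3, q4, q5, q6, tot, tq, tp, pen, h1, h5])
      have h67 := hqp.congr_bound 3 {3} {1, 2, 3, 4} (by decide) (by decide) (by decide) (by
          decide)
      norm_num at h67
      rcases h67 with h67 | h67
      · linarith only [hN, h_err, sq', wp, wq, p1, p2, p3, p4, p5, p6, q1, q2, q3, q4, q5, q6, sp,
            tot, tq, tp, h2, h5, h35, h66, h67]
      · have h68 := hpq.power_bound 2 3 {2, 4} {3} (by decide) (by decide) (by decide) (by decide)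
            (by decide) (by decide)
        norm_num at h68
        have h69 := hpq.power_bound 3 3 {3} {3} (by decide) (by decide) (by decide) (by decide)
            (by decide) (by decide)
        norm_num at h69
        linarith only [hN, h_err, sq', wp, wq, p1, p2, p3, p4, p5, p6, q1, q2, q3, q4, q5, q6,
            tot, tq, tp, h4, h35, h67, h68, h69]

theorem sum_Icc_one_five (f : ℕ → ℝ) : ∑ i ∈ Icc 1 5, f i = f 1 + f 2 + f 3 + f 4 + f 5 := by
  simp [sum_Icc_succ_top]

theorem sum_Icc_one_six (f : ℕ → ℝ) :
    ∑ i ∈ Icc 1 6, f i = f 1 + f 2 + f 3 + f 4 + f 5 + f 6 := by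
  simp [sum_Icc_succ_top]

/-- A finite set of triples `(p, q, r)` with `r = ± p ± q`, `p` and `q` coprime, whose entries have
constant dyadic sizes; `2 ^ d` bounds the number of divisors and the number of integers with a given
radical. -/
structure TripleBox (T : Finset (ℕ × ℕ × ℕ)) (κ μ ν : ℕ → ℕ) (X : ℕ) (d : ℝ) : Prop where
  rel : ∃ σ τ : ℤ, IsUnit σ ∧ IsUnit τ ∧ ∀ t ∈ T, (t.2.2 : ℤ) = σ * t.1 + τ * t.2.1
  cop : ∀ t ∈ T, t.1.Coprime t.2.1
  fst : IsBox X κ (T.image (·.1))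
  snd : IsBox X μ (T.image (·.2.1))
  thd : IsBox X ν (T.image (·.2.2))
  nonneg : 0 ≤ d
  divisors_le : ∀ n, n ≠ 0 → n ≤ X → (#n.divisors : ℝ) ≤ 2 ^ d
  rad_le : ∀ m, (#{n ∈ Icc 1 X | rad n = m} : ℝ) ≤ 2 ^ d

namespace TripleBox

variable {T : Finset (ℕ × ℕ × ℕ)} {κ μ ν : ℕ → ℕ} {X : ℕ} {d : ℝ}

theorem fst' (h : TripleBox T κ μ ν X d) {t : ℕ × ℕ × ℕ} (ht : t ∈ T) :
    t.1 ≠ 0 ∧ t.1 ≤ X ∧ boxKey t.1 = κ := h.fst _ (mem_image_of_mem _ ht)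

theorem snd' (h : TripleBox T κ μ ν X d) {t : ℕ × ℕ × ℕ} (ht : t ∈ T) :
    t.2.1 ≠ 0 ∧ t.2.1 ≤ X ∧ boxKey t.2.1 = μ := h.snd _ (mem_image_of_mem _ ht)

theorem image_swap (h : TripleBox T κ μ ν X d) :
    TripleBox (T.image fun t => (t.2.1, t.1, t.2.2)) μ κ ν X d where
  rel := by
    obtain ⟨σ, τ, hσ, hτ, h1⟩ := h.rel
    refine ⟨τ, σ, hτ, hσ, fun t ht => ?_⟩
    obtain ⟨s, hs, rfl⟩ := mem_image.mp ht
    rw [h1 s hs, add_comm]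
  cop := fun t ht => by
    obtain ⟨s, hs, rfl⟩ := mem_image.mp ht
    exact (h.cop s hs).symm
  fst := by rw [image_image]; exact h.snd
  snd := by rw [image_image]; exact h.fst
  thd := by rw [image_image]; exact h.thd
  nonneg := h.nonneg
  divisors_le := h.divisors_le
  rad_le := h.rad_le

theorem card_image_swap (T : Finset (ℕ × ℕ × ℕ)) :
    #(T.image fun t => (t.2.1, t.1, t.2.2)) = #T :=
  card_image_of_injective _ fun x y h => by
    simp only [Prod.mk.injEq] at h
    exact Prod.ext h.2.1 (Prod.ext h.1 h.2.2)

/-- Bound for the number of triples with given cofactors. -/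
theorem card_filter_le (h : TripleBox T κ μ ν X d) {I J : Finset ℕ} (hI : I ⊆ Icc 1 5)
    (hJ : J ⊆ Icc 1 5) (u : ℕ × ℕ) :
    (#{t ∈ T | (cofactor I t.1, cofactor J t.2.1) = u} : ℝ) ≤
      2 ^ (∑ i ∈ I, (κ i : ℝ) + ∑ j ∈ J, (μ j : ℝ) + 10) := by
  obtain ⟨σ, τ, hσ, hτ, hrel⟩ := h.rel
  set A := (T.image (·.1)).image fun n => ∏ i ∈ I, exactPart i n ^ id i
  set B := (T.image (·.2.1)).image fun n => ∏ i ∈ J, exactPart i n ^ id i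
  have h1 : #{t ∈ T | (cofactor I t.1, cofactor J t.2.1) = u} ≤ #A * #B := by
    rw [← card_product]
    refine card_le_card_of_injOn
      (fun t => (∏ i ∈ I, exactPart i t.1 ^ id i, ∏ i ∈ J, exactPart i t.2.1 ^ id i)) ?_ ?_
    · intro t ht
      have ht' := (mem_filter.mp ht).1
      exact mem_product.mpr ⟨mem_image_of_mem _ (mem_image_of_mem _ ht'),
        mem_image_of_mem _ (mem_image_of_mem _ ht')⟩
    · intro x hx y hy hxy
      obtain ⟨hx, hxu⟩ := mem_filter.mp hx
      obtain ⟨hy, hyu⟩ := mem_filter.mp hy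
      obtain ⟨e1, e2⟩ := Prod.mk.inj (hxu.trans hyu.symm)
      obtain ⟨e3, e4⟩ := Prod.mk.inj hxy
      simp only [id] at e3 e4
      have p1 : x.1 = y.1 := by
        rw [← cofactor_mul_prod hI (h.fst' hx).1, ← cofactor_mul_prod hI (h.fst' hy).1, e1, e3]
      have p2 : x.2.1 = y.2.1 := by
        rw [← cofactor_mul_prod hJ (h.snd' hx).1, ← cofactor_mul_prod hJ (h.snd' hy).1, e2, e4]
      have p3 : x.2.2 = y.2.2 := by
        have := hrel x hx
        rw [p1, p2, ← hrel y hy] at this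
        exact_mod_cast this
      exact Prod.ext p1 (Prod.ext p2 p3)
  calc _ ≤ ((#A * #B : ℕ) : ℝ) := by exact_mod_cast h1
    _ ≤ 2 ^ (∑ i ∈ I, (κ i : ℝ) + 5) * 2 ^ (∑ j ∈ J, (μ j : ℝ) + 5) := by
      push_cast
      gcongr
      · exact h.fst.card_image_prod_exactPart_le hI id
      · exact h.snd.card_image_prod_exactPart_le hJ id
    _ = _ := by
      rw [← Real.rpow_add (by norm_num)]
      congr 1
      ring

theorem two_mul_logb_card_le (h : TripleBox T κ μ ν X d) (hT : T.Nonempty) {I J : Finset ℕ}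
    (hI : I ⊆ Icc 1 5) (hJ : J ⊆ Icc 1 5) {w : ℝ}
    (hw : ∀ u, (#{x ∈ {t ∈ T | (cofactor I t.1, cofactor J t.2.1) = u} ×ˢ
      {t ∈ T | (cofactor I t.1, cofactor J t.2.1) = u} | x.1.2.2 = x.2.2.2} : ℝ) ≤ 2 ^ w) :
    2 * Real.logb 2 #T ≤ 2 * ∑ i ∈ Icc 1 6, (κ i : ℝ) + 2 * ∑ i ∈ Icc 1 6, (μ i : ℝ) +
      ∑ i ∈ Icc 1 6, (ν i : ℝ) - 2 * (∑ i ∈ I, (κ i : ℝ) + ∑ j ∈ J, (μ j : ℝ)) + w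
        + (30 + 5 * d) := by
  have h1 := sq_card_le_of_card_pairs_le T (fun t => (cofactor I t.1, cofactor J t.2.1))
    (fun t => t.2.2) (fun u => Nat.le_floor (hw u))
  have h2 : #(T.image fun t => (cofactor I t.1, cofactor J t.2.1)) ≤
      #((T.image (·.1)).image (cofactor I)) * #((T.image (·.2.1)).image (cofactor J)) := by
    rw [← card_product]
    refine card_le_card fun x hx => ?_
    obtain ⟨t, ht, rfl⟩ := mem_image.mp hx
    exact mem_product.mpr ⟨mem_image_of_mem _ (mem_image_of_mem _ ht),
      mem_image_of_mem _ (mem_image_of_mem _ ht)⟩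
  have hE := h.fst.card_image_cofactor_le h.rad_le I
  have hF := h.snd.card_image_cofactor_le h.rad_le J
  have hR := h.thd.card_le h.rad_le
  have h3 : (#T : ℝ) ^ 2 ≤ 2 ^ ((∑ i ∈ Icc 1 5 \ I, (κ i : ℝ) + κ 6 + 6 + d) * 2 +
      (∑ i ∈ Icc 1 5 \ J, (μ i : ℝ) + μ 6 + 6 + d) * 2 +
      (∑ i ∈ Icc 1 5, (ν i : ℝ) + ν 6 + 6 + d) + w) := by
    calc (#T : ℝ) ^ 2 ≤ ((#((T.image (·.1)).image (cofactor I)) *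
          #((T.image (·.2.1)).image (cofactor J))) ^ 2 * #(T.image (·.2.2)) *
          ⌊(2 : ℝ) ^ w⌋₊ : ℕ) := by
          refine (Nat.cast_le.mpr ?_).trans' (Nat.cast_pow _ _).symm.le
          refine h1.trans ?_
          gcongr
      _ ≤ (2 ^ (∑ i ∈ Icc 1 5 \ I, (κ i : ℝ) + κ 6 + 6 + d) *
          2 ^ (∑ i ∈ Icc 1 5 \ J, (μ i : ℝ) + μ 6 + 6 + d)) ^ 2 *
          2 ^ (∑ i ∈ Icc 1 5, (ν i : ℝ) + ν 6 + 6 + d) * 2 ^ w := by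
          push_cast
          gcongr
          exact Nat.floor_le (by positivity)
      _ = _ := by
          have h2 : (0 : ℝ) ≤ 2 := by norm_num
          have h2' : (0 : ℝ) < 2 := by norm_num
          rw [mul_pow, ← Real.rpow_mul_natCast h2, ← Real.rpow_mul_natCast h2, ← Real.rpow_add h2',
            ← Real.rpow_add h2', ← Real.rpow_add h2']
          norm_num
  have hT0 : (0 : ℝ) < #T := by exact_mod_cast hT.card_pos
  have h4 := Real.logb_le_logb_of_le (b := 2) (by norm_num) (by positivity) h3
  rw [Real.logb_pow, Real.logb_rpow (by norm_num) (by norm_num)] at h4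
  have sI := sum_sdiff (f := fun i => (κ i : ℝ)) hI
  have sJ := sum_sdiff (f := fun i => (μ i : ℝ)) hJ
  simp only [sum_Icc_succ_top (show 1 ≤ 5 + 1 by norm_num)] at *
  push_cast at h4
  linarith

theorem power_bound_aux (h : TripleBox T κ μ ν X d) (hT : T.Nonempty) {g : ℕ} {I J : Finset ℕ}
    (hg : 2 ≤ g) (hI : I ⊆ Icc 1 5) (hJ : J ⊆ Icc 1 5) (hgI : ∀ i ∈ I, g ∣ i)
    (hIJ : ∑ j ∈ J, (μ j : ℝ) ≤ ∑ i ∈ I, (κ i : ℝ)) :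
    2 * Real.logb 2 #T ≤ 2 * ∑ i ∈ Icc 1 6, (κ i : ℝ) + 2 * ∑ i ∈ Icc 1 6, (μ i : ℝ) +
      ∑ i ∈ Icc 1 6, (ν i : ℝ) - (∑ i ∈ I, (κ i : ℝ) + ∑ j ∈ J, (μ j : ℝ)) + (42 + 6 * d) := by
  have hw := h.two_mul_logb_card_le hT hI hJ
    (w := ∑ i ∈ I, (κ i : ℝ) + ∑ j ∈ J, (μ j : ℝ) + 12 + d) ?_
  · linarith
  intro u
  set U := {t ∈ T | (cofactor I t.1, cofactor J t.2.1) = u}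
  have hU : ∀ t ∈ U, t ∈ T ∧ cofactor I t.1 = u.1 ∧ cofactor J t.2.1 = u.2 := fun t ht => by
    obtain ⟨h1, h2⟩ := mem_filter.mp ht
    exact ⟨h1, congrArg Prod.fst h2, congrArg Prod.snd h2⟩
  rcases U.eq_empty_or_nonempty with h0 | ⟨t₀, ht₀⟩
  · rw [h0, product_empty, filter_empty, card_empty, Nat.cast_zero]
    positivity
  obtain ⟨σ, τ, hσ, hτ, hrel⟩ := h.rel
  have h1 := card_pairs_le_of_pow (T := U) (e := u.1)
    (A := fun n => ∏ i ∈ I, exactPart i n ^ (i / g))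
    (d := ⌊(2 : ℝ) ^ d⌋₊) (X := X) (g := g) hσ hτ ((hU t₀ ht₀).2.1 ▸ (cofactor_pos _ _).ne')
    (fun t ht => hrel t (hU t ht).1) (fun t ht => ?_) hg (fun t ht => (h.fst' (hU t ht).1).2.1)
    (fun n hn hnX => Nat.le_floor (h.divisors_le n hn hnX))
  · have h2 := h.card_filter_le hI hJ u
    have h3 : #(U.image (·.2.1)) ≤
        #((T.image (·.2.1)).image fun n => ∏ i ∈ J, exactPart i n ^ id i) := by
      have : U.image (·.2.1) ⊆
          ((T.image (·.2.1)).image fun n => ∏ i ∈ J, exactPart i n ^ id i).image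
          (u.2 * ·) := by
        intro x hx
        obtain ⟨t, ht, rfl⟩ := mem_image.mp hx
        refine mem_image.mpr ⟨_, mem_image_of_mem _ (mem_image_of_mem _ (hU t ht).1), ?_⟩
        rw [← (hU t ht).2.2]
        exact cofactor_mul_prod hJ (h.snd' (hU t ht).1).1
      exact (card_le_card this).trans card_image_le
    have h4 := h.snd.card_image_prod_exactPart_le hJ id
    have hd1 : (1 : ℝ) ≤ 2 ^ d := Real.one_le_rpow (by norm_num) h.nonneg
    calc _ ≤ ((#U + 2 * ⌊(2 : ℝ) ^ d⌋₊ *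
          #((T.image (·.2.1)).image fun n => ∏ i ∈ J, exactPart i n ^ id i) ^ 2 : ℕ) : ℝ) := by
          refine Nat.cast_le.mpr (h1.trans ?_)
          gcongr
      _ ≤ 2 ^ (∑ i ∈ I, (κ i : ℝ) + ∑ j ∈ J, (μ j : ℝ) + 10) +
          2 * 2 ^ d * (2 ^ (∑ j ∈ J, (μ j : ℝ) + 5)) ^ 2 := by
          push_cast
          gcongr
          exact Nat.floor_le (by positivity)
      _ ≤ 2 ^ (∑ i ∈ I, (κ i : ℝ) + ∑ j ∈ J, (μ j : ℝ) + 10) +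
          2 * 2 ^ d * 2 ^ (∑ i ∈ I, (κ i : ℝ) + ∑ j ∈ J, (μ j : ℝ) + 10) := by
          gcongr
          rw [sq, ← Real.rpow_add (by norm_num)]
          exact Real.rpow_le_rpow_of_exponent_le (by norm_num) (by linarith)
      _ ≤ 2 ^ 2 * 2 ^ d * 2 ^ (∑ i ∈ I, (κ i : ℝ) + ∑ j ∈ J, (μ j : ℝ) + 10) := by
          nlinarith [Real.rpow_pos_of_pos (show (0 : ℝ) < 2 by norm_num)
            (∑ i ∈ I, (κ i : ℝ) + ∑ j ∈ J, (μ j : ℝ) + 10)]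
      _ = _ := by
          rw [← Real.rpow_natCast, ← Real.rpow_add (by norm_num), ← Real.rpow_add (by norm_num)]
          congr 1
          push_cast
          ring
  · obtain ⟨h2, h3, -⟩ := hU t ht
    conv_lhs => rw [← cofactor_mul_prod hI (h.fst' h2).1, h3]
    rw [← prod_pow]
    congr 1
    refine prod_congr rfl fun i hi => ?_
    rw [← pow_mul, Nat.div_mul_cancel (hgI i hi)]

theorem power_bound (h : TripleBox T κ μ ν X d) (hT : T.Nonempty) {g k : ℕ} {I J : Finset ℕ}
    (hg : 2 ≤ g) (hk : 2 ≤ k) (hI : I ⊆ Icc 1 5) (hJ : J ⊆ Icc 1 5) (hgI : ∀ i ∈ I, g ∣ i)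
    (hkJ : ∀ j ∈ J, k ∣ j) :
    2 * Real.logb 2 #T ≤ 2 * ∑ i ∈ Icc 1 6, (κ i : ℝ) + 2 * ∑ i ∈ Icc 1 6, (μ i : ℝ) +
      ∑ i ∈ Icc 1 6, (ν i : ℝ) - (∑ i ∈ I, (κ i : ℝ) + ∑ j ∈ J, (μ j : ℝ)) + (42 + 6 * d) := by
  rcases le_total (∑ j ∈ J, (μ j : ℝ)) (∑ i ∈ I, (κ i : ℝ)) with hIJ | hIJ
  · exact h.power_bound_aux hT hg hI hJ hgI hIJ
  · have := h.image_swap.power_bound_aux (hT.image _) hk hJ hI hkJ hIJ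
    rw [card_image_swap] at this
    linarith

theorem congr_bound_aux (h : TripleBox T κ μ ν X d) (hT : T.Nonempty) {g : ℕ} {I J : Finset ℕ}
    (hg : 0 < g) (hg8 : g ≤ 8) (hI : I ⊆ Icc 1 5) (hJ : J ⊆ Icc 1 5) (hgI : ∀ i ∈ I, g ∣ i) :
    2 * Real.logb 2 #T ≤ 2 * ∑ i ∈ Icc 1 6, (κ i : ℝ) + 2 * ∑ i ∈ Icc 1 6, (μ i : ℝ) +
      ∑ i ∈ Icc 1 6, (ν i : ℝ) - (∑ i ∈ I, (κ i : ℝ) + ∑ j ∈ J, (μ j : ℝ)) +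
      max (∑ i ∈ I, ((i / g : ℕ) : ℝ) * κ i + ∑ j ∈ J, ((j : ℕ) : ℝ) * μ j
        - (∑ j ∈ Icc 1 5, ((j : ℕ) : ℝ) * μ j + μ 7) + 15) 0 + (41 + 9 * d) := by
  set m := ∑ i ∈ I, ((i / g : ℕ) : ℝ) * κ i + ∑ j ∈ J, ((j : ℕ) : ℝ) * μ j
        - (∑ j ∈ Icc 1 5, ((j : ℕ) : ℝ) * μ j + μ 7) + 15
  have hw := h.two_mul_logb_card_le hT hI hJ
    (w := ∑ i ∈ I, (κ i : ℝ) + ∑ j ∈ J, (μ j : ℝ) + 10 + 4 * d + (max m 0 + 1)) ?_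
  · linarith
  intro u
  set U := {t ∈ T | (cofactor I t.1, cofactor J t.2.1) = u}
  have hU : ∀ t ∈ U, t ∈ T ∧ cofactor I t.1 = u.1 ∧ cofactor J t.2.1 = u.2 := fun t ht => by
    obtain ⟨h1, h2⟩ := mem_filter.mp ht
    exact ⟨h1, congrArg Prod.fst h2, congrArg Prod.snd h2⟩
  rcases U.eq_empty_or_nonempty with h0 | ⟨t₀, ht₀⟩
  · rw [h0, product_empty, filter_empty, card_empty, Nat.cast_zero]
    positivity
  obtain ⟨σ, τ, hσ, hτ, hrel⟩ := h.rel
  have hu0 : u.2 ≠ 0 := (hU t₀ ht₀).2.2 ▸ (cofactor_pos _ _).ne'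
  have huX : u.2 ≤ X := by
    rw [← (hU t₀ ht₀).2.2]
    obtain ⟨h1, h2, -⟩ := h.snd' (hU t₀ ht₀).1
    exact (Nat.le_of_dvd (by lia) (Dvd.intro _ (cofactor_mul_prod hJ h1))).trans h2
  have h1 := card_pairs_le_of_congr (T := U) (e := u.1) (f := u.2) (g := g)
    (A := fun n => ∏ i ∈ I, exactPart i n ^ (i / g)) (B := fun n => ∏ i ∈ J, exactPart i n ^ i)
    (H := 2 ^ ∑ i ∈ I, i / g * (κ i + 1)) hσ hτ hu0
    (fun t ht => hrel t (hU t ht).1) (fun t ht => h.cop t (hU t ht).1) (fun t ht => ?_)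
    (fun t ht => ?_) hg.ne' (fun t ht => ?_)
  · have h2 := h.card_filter_le hI hJ u
    have hK : (Nat.card (powMonoidHom g : (ZMod u.2)ˣ →* (ZMod u.2)ˣ).ker : ℝ) ≤ 2 ^ (4 * d) := by
      have h3 := (ZMod.card_ker_powMonoidHom_le hg hu0).trans
        (Nat.pow_le_pow_left (by lia : 2 * g ≤ 2 ^ 4) _)
      rw [← pow_mul, mul_comm, pow_mul] at h3
      have h4 := h3.trans (Nat.pow_le_pow_left (Nat.two_pow_card_primeFactors_le hu0) 4)
      calc _ ≤ ((#u.2.divisors ^ 4 : ℕ) : ℝ) := by exact_mod_cast h4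
        _ ≤ ((2 : ℝ) ^ d) ^ 4 := by
          push_cast
          gcongr
          exact h.divisors_le _ hu0 huX
        _ = _ := by
          rw [← Real.rpow_mul_natCast (by norm_num)]
          norm_num [mul_comm]
    have hH : ((2 ^ (∑ i ∈ I, i / g * (κ i + 1)) / u.2 : ℕ) : ℝ) + 1 ≤ 2 ^ (max m 0 + 1) := by
      have h3 : (2 : ℝ) ^ (∑ j ∈ Icc 1 5 \ J, ((j : ℕ) : ℝ) * μ j + μ 7) ≤ u.2 := by
        have h4 := two_pow_le_cofactor J t₀.2.1
        rw [(hU t₀ ht₀).2.2, (h.snd' (hU t₀ ht₀).1).2.2] at h4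
        refine le_trans (le_of_eq ?_) (Nat.cast_le.mpr h4)
        rw [Nat.cast_pow, ← Real.rpow_natCast]
        push_cast
        rfl
      have h4 : ((2 ^ (∑ i ∈ I, i / g * (κ i + 1)) : ℕ) : ℝ) ≤
          2 ^ (∑ i ∈ I, ((i / g : ℕ) : ℝ) * κ i + 15) := by
        rw [Nat.cast_pow, ← Real.rpow_natCast]
        push_cast
        refine Real.rpow_le_rpow_of_exponent_le (by norm_num) ?_
        have h5 : ∑ i ∈ I, i / g ≤ 15 := calc
          ∑ i ∈ I, i / g ≤ ∑ i ∈ I, i := sum_le_sum fun i _ => Nat.div_le_self i g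
          _ ≤ ∑ i ∈ Icc 1 5, i := sum_le_sum_of_subset hI
          _ = 15 := by decide
        have h6 : ∑ i ∈ I, ((i / g : ℕ) : ℝ) ≤ 15 := by exact_mod_cast h5
        simp only [mul_add, sum_add_distrib, mul_one]
        linarith
      have h5 : ((2 ^ (∑ i ∈ I, i / g * (κ i + 1)) / u.2 : ℕ) : ℝ) ≤ 2 ^ m := by
        refine Nat.cast_div_le.trans ?_
        rw [div_le_iff₀ (by positivity)]
        refine h4.trans ?_
        refine le_trans (le_of_eq ?_) (mul_le_mul_of_nonneg_left h3 (by positivity))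
        rw [← Real.rpow_add (by norm_num)]
        have := sum_sdiff (f := fun j : ℕ => (j : ℝ) * μ j) hJ
        congr 1
        simp only [m]
        linarith
      have h6 : (2 : ℝ) ^ m ≤ 2 ^ max m 0 :=
        Real.rpow_le_rpow_of_exponent_le (by norm_num) (le_max_left _ _)
      have h7 : (1 : ℝ) ≤ 2 ^ max m 0 := Real.one_le_rpow (by norm_num) (le_max_right _ _)
      rw [Real.rpow_add (by norm_num), Real.rpow_one]
      linarith
    calc _ ≤ (((2 ^ (∑ i ∈ I, i / g * (κ i + 1)) / u.2 + 1) *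
          Nat.card (powMonoidHom g : (ZMod u.2)ˣ →* (ZMod u.2)ˣ).ker * #U : ℕ) : ℝ) := by
          exact_mod_cast h1
      _ ≤ 2 ^ (max m 0 + 1) * 2 ^ (4 * d) *
          2 ^ (∑ i ∈ I, (κ i : ℝ) + ∑ j ∈ J, (μ j : ℝ) + 10) := by
          rw [Nat.cast_mul, Nat.cast_mul, Nat.cast_add, Nat.cast_one]
          gcongr
      _ = _ := by
          rw [← Real.rpow_add (by norm_num), ← Real.rpow_add (by norm_num)]
          congr 1
          ring
  · obtain ⟨h2, h3, -⟩ := hU t ht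
    conv_lhs => rw [← cofactor_mul_prod hI (h.fst' h2).1, h3]
    rw [← prod_pow]
    congr 1
    refine prod_congr rfl fun i hi => ?_
    rw [← pow_mul, Nat.div_mul_cancel (hgI i hi)]
  · obtain ⟨h2, -, h3⟩ := hU t ht
    rw [← h3]
    exact (cofactor_mul_prod hJ (h.snd' h2).1).symm
  · rw [← (h.fst' (hU t ht).1).2.2]
    exact prod_exactPart_le_two_pow_sum hI _ _

theorem congr_bound (h : TripleBox T κ μ ν X d) (hT : T.Nonempty) {g : ℕ} {I J : Finset ℕ}
    (hg : 0 < g) (hI : I ⊆ Icc 1 5) (hJ : J ⊆ Icc 1 5) (hgI : ∀ i ∈ I, g ∣ i) :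
    2 * Real.logb 2 #T ≤ 2 * ∑ i ∈ Icc 1 6, (κ i : ℝ) + 2 * ∑ i ∈ Icc 1 6, (μ i : ℝ) +
      ∑ i ∈ Icc 1 6, (ν i : ℝ) - (∑ i ∈ I, (κ i : ℝ) + ∑ j ∈ J, (μ j : ℝ)) +
      max (∑ i ∈ I, ((i / g : ℕ) : ℝ) * κ i + ∑ j ∈ J, ((j : ℕ) : ℝ) * μ j
        - (∑ j ∈ Icc 1 5, ((j : ℕ) : ℝ) * μ j + μ 7) + 15) 0 + (41 + 9 * d) := by
  rcases I.eq_empty_or_nonempty with rfl | ⟨i, hi⟩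
  · simpa using h.congr_bound_aux hT one_pos (by norm_num) hI hJ (by simp)
  · have h1 := mem_Icc.mp (hI hi)
    have h2 := Nat.le_of_dvd (by lia) (hgI i hi)
    exact h.congr_bound_aux hT hg (by lia) hI hJ hgI

theorem pairBounds (h : TripleBox T κ μ ν X d) (hT : T.Nonempty) {e : ℝ} (he : 60 + 9 * d ≤ e) :
    PairBounds (fun i => κ i) (fun i => μ i) (∑ i ∈ Icc 1 6, (ν i : ℝ)) (Real.logb 2 #T) e where
  congr_bound := by
    intro g I J hg hI hJ hgI
    have h1 := h.congr_bound hT hg hI hJ hgI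
    have := h.nonneg
    rw [sum_Icc_one_six fun i => (κ i : ℝ), sum_Icc_one_six fun i => (μ i : ℝ),
      sum_Icc_one_five fun i => (i : ℝ) * μ i] at h1
    norm_num at h1
    rw [max_def] at h1
    split_ifs at h1
    · exact .inl (by linarith)
    · exact .inr (by linarith)
  power_bound := by
    intro g k I J hg hk hI hJ hgI hkJ
    have h1 := h.power_bound hT hg hk hI hJ hgI hkJ
    have := h.nonneg
    rw [sum_Icc_one_six fun i => (κ i : ℝ), sum_Icc_one_six fun i => (μ i : ℝ)] at h1
    linarith

end TripleBox

/-- Primitive integer points of a dyadic box whose pairwise determinants are divisible by `g`. -/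
theorem Nat.card_le_of_dvd_det {S : Finset (ℕ × ℕ)} {g X Y : ℕ} (hg : 0 < g) (hY : 0 < Y)
    (hx : ∀ z ∈ S, z.1 ≤ 2 * X) (hy : ∀ z ∈ S, Y ≤ z.2 ∧ z.2 ≤ 2 * Y)
    (hcop : ∀ z ∈ S, z.1.Coprime z.2)
    (hdvd : ∀ z ∈ S, ∀ w ∈ S, (g : ℤ) ∣ z.1 * w.2 - w.1 * z.2) :
    #S ≤ 8 * X * Y / g + 1 := by
  have key : ∀ z ∈ S, ∀ w ∈ S, 4 * Y ^ 2 * z.1 / (z.2 * g) = 4 * Y ^ 2 * w.1 / (w.2 * g) →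
      (z.1 : ℤ) * w.2 - w.1 * z.2 < g := by
    intro z hz w hw h
    have hz2 : 0 < z.2 * g := Nat.mul_pos (hY.trans_le (hy z hz).1) hg
    have hw2 : 0 < w.2 * g := Nat.mul_pos (hY.trans_le (hy w hw).1) hg
    have h1 := Nat.lt_mul_div_succ (4 * Y ^ 2 * z.1) hz2
    have h2 := Nat.mul_div_le (4 * Y ^ 2 * w.1) (w.2 * g)
    rw [h] at h1
    set k := 4 * Y ^ 2 * w.1 / (w.2 * g)
    have h3 : 4 * Y ^ 2 * z.1 * w.2 < z.2 * g * (k + 1) * w.2 :=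
      Nat.mul_lt_mul_of_pos_right h1 (hY.trans_le (hy w hw).1)
    have h4 : w.2 * g * k * z.2 ≤ 4 * Y ^ 2 * w.1 * z.2 := Nat.mul_le_mul_right _ h2
    have h5 : z.2 * w.2 ≤ 2 * Y * (2 * Y) := Nat.mul_le_mul (hy z hz).2 (hy w hw).2
    have h6 : z.2 * w.2 * g ≤ 2 * Y * (2 * Y) * g := Nat.mul_le_mul_right _ h5
    have h7 : (4 * (Y : ℤ) ^ 2) * ((z.1 : ℤ) * w.2 - w.1 * z.2) < (4 * (Y : ℤ) ^ 2) * g := by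
      zify at h3 h4 h6
      linarith
    exact lt_of_mul_lt_mul_left h7 (by positivity)
  rw [← card_range (8 * X * Y / g + 1)]
  refine card_le_card_of_injOn (fun z => 4 * Y ^ 2 * z.1 / (z.2 * g)) ?_ ?_
  · intro z hz
    rw [mem_coe, mem_range, Nat.lt_succ_iff]
    calc 4 * Y ^ 2 * z.1 / (z.2 * g) ≤ 4 * Y ^ 2 * (2 * X) / (Y * g) :=
          Nat.div_le_div (Nat.mul_le_mul_left _ (hx z hz)) (Nat.mul_le_mul_right _ (hy z hz).1)
            (by positivity)
      _ = 8 * X * Y / g := by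
        rw [show 4 * Y ^ 2 * (2 * X) = Y * (8 * X * Y) by ring, Nat.mul_div_mul_left _ _ hY]
  · intro z hz w hw h
    have h1 := key z hz w hw h
    have h2 := key w hw z hz h.symm
    have h3 : (z.1 : ℤ) * w.2 - w.1 * z.2 = 0 :=
      Int.eq_zero_of_abs_lt_dvd (hdvd z hz w hw) (abs_lt.mpr ⟨by linarith, h1⟩)
    have h4 : z.1 * w.2 = w.1 * z.2 := by zify; linarith
    have h5 : z.2 = w.2 := Nat.dvd_antisymm
      ((hcop z hz).symm.dvd_of_dvd_mul_left (Dvd.intro_left _ h4.symm))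
      ((hcop w hw).symm.dvd_of_dvd_mul_left (Dvd.intro_left _ h4))
    rw [h5] at h4
    exact Prod.ext (Nat.eq_of_mul_eq_mul_right (hY.trans_le (hy w hw).1) h4) h5

namespace TripleBox

variable {T : Finset (ℕ × ℕ × ℕ)} {κ μ ν : ℕ → ℕ} {X : ℕ} {d : ℝ}

theorem thd' (h : TripleBox T κ μ ν X d) {t : ℕ × ℕ × ℕ} (ht : t ∈ T) :
    t.2.2 ≠ 0 ∧ t.2.2 ≤ X ∧ boxKey t.2.2 = ν := h.thd _ (mem_image_of_mem _ ht)

theorem logb_card_le_sub (h : TripleBox T κ μ ν X d) (hT : T.Nonempty) {e : ℝ} (he : 0 ≤ e)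
    (hν : (κ 1 : ℝ) + μ 1 + ν 1 ≤ ∑ i ∈ Icc 1 5, ((i : ℕ) : ℝ) * ν i + ν 7 + e) :
    Real.logb 2 #T ≤ ∑ i ∈ Icc 1 6, (κ i : ℝ) + ∑ i ∈ Icc 1 6, (μ i : ℝ) +
      ∑ i ∈ Icc 1 6, (ν i : ℝ) - (κ 1 + μ 1 + ν 1) + (22 + 3 * d + e) := by
  obtain ⟨σ, τ, hσ, hτ, hrel⟩ := h.rel
  have h1m : {1} ⊆ Icc 1 5 := by decide
  have hmul : ∀ n, n ≠ 0 → cofactor {1} n * exactPart 1 n = n := fun n hn => by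
    simpa using cofactor_mul_prod h1m hn
  have hpart : ∀ n, 2 ^ boxKey n 1 ≤ exactPart 1 n ∧ exactPart 1 n ≤ 2 * 2 ^ boxKey n 1 :=
    fun n => ⟨two_pow_boxKey_le (by simp), by
      rw [← pow_succ']; exact (exactPart_lt (by simp)).le⟩
  have h_fiber : ∀ u : ℕ × ℕ × ℕ, #{t ∈ T | (cofactor {1} t.1, cofactor {1} t.2.1,
      cofactor {1} t.2.2) = u} ≤ ⌊(2 : ℝ) ^ (4 + e)⌋₊ := by
    intro u
    set U := {t ∈ T | (cofactor {1} t.1, cofactor {1} t.2.1, cofactor {1} t.2.2) = u}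
    have hU : ∀ t ∈ U, t ∈ T ∧ u.1 * exactPart 1 t.1 = t.1 ∧ u.2.1 * exactPart 1 t.2.1 = t.2.1 ∧
        u.2.2 * exactPart 1 t.2.2 = t.2.2 := fun t ht => by
      obtain ⟨h1, rfl⟩ := mem_filter.mp ht
      exact ⟨h1, hmul _ (h.fst' h1).1, hmul _ (h.snd' h1).1, hmul _ (h.thd' h1).1⟩
    rcases U.eq_empty_or_nonempty with h0 | ⟨t₀, ht₀⟩
    · simp [h0]
    have hg : (2 : ℝ) ^ (∑ i ∈ Icc 1 5, ((i : ℕ) : ℝ) * ν i - ν 1 + ν 7) ≤ u.2.2 := by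
      obtain ⟨h1, h2⟩ := mem_filter.mp ht₀
      have h3 := two_pow_le_cofactor {1} t₀.2.2
      rw [show cofactor {1} t₀.2.2 = u.2.2 from congrArg (·.2.2) h2, (h.thd' h1).2.2] at h3
      refine le_trans (le_of_eq ?_) (Nat.cast_le.mpr h3)
      rw [Nat.cast_pow, ← Real.rpow_natCast]
      have := sum_sdiff (f := fun i : ℕ => (i : ℝ) * ν i) h1m
      rw [sum_singleton] at this
      push_cast
      congr 1
      push_cast at this
      linarith
    have hg0 : 0 < u.2.2 := (Nat.cast_pos (α := ℝ)).mp (lt_of_lt_of_le (by positivity) hg)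
    have h1 : #U = #(U.image fun t => (exactPart 1 t.1, exactPart 1 t.2.1)) := by
      rw [card_image_of_injOn]
      intro x hx y hy hxy
      obtain ⟨hx0, hx1, hx2, -⟩ := hU x hx
      obtain ⟨hy0, hy1, hy2, -⟩ := hU y hy
      obtain ⟨e1, e2⟩ := Prod.mk.inj hxy
      have p1 : x.1 = y.1 := by rw [← hx1, ← hy1, e1]
      have p2 : x.2.1 = y.2.1 := by rw [← hx2, ← hy2, e2]
      have p3 : x.2.2 = y.2.2 := by
        have := hrel x hx0
        rw [p1, p2, ← hrel y hy0] at this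
        exact_mod_cast this
      exact Prod.ext p1 (Prod.ext p2 p3)
    have h2 : #U ≤ 8 * 2 ^ κ 1 * 2 ^ μ 1 / u.2.2 + 1 := by
      rw [h1]
      refine Nat.card_le_of_dvd_det hg0 (by positivity) ?_ ?_ ?_ ?_
      · intro z hz
        obtain ⟨t, ht, rfl⟩ := mem_image.mp hz
        rw [← (h.fst' (hU t ht).1).2.2]
        exact (hpart _).2
      · intro z hz
        obtain ⟨t, ht, rfl⟩ := mem_image.mp hz
        rw [← (h.snd' (hU t ht).1).2.2]
        exact hpart _
      · intro z hz
        obtain ⟨t, ht, rfl⟩ := mem_image.mp hz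
        obtain ⟨ht0, ht1, ht2, -⟩ := hU t ht
        exact (h.cop t ht0).of_dvd (Dvd.intro_left _ ht1) (Dvd.intro_left _ ht2)
      · intro z hz w hw
        obtain ⟨t, ht, rfl⟩ := mem_image.mp hz
        obtain ⟨s, hs, rfl⟩ := mem_image.mp hw
        obtain ⟨ht0, ht1, ht2, ht3⟩ := hU t ht
        obtain ⟨hs0, hs1, hs2, hs3⟩ := hU s hs
        have e1 := hrel t ht0
        have e2 := hrel s hs0
        have hcop : IsCoprime (u.2.2 : ℤ) u.1 := by
          have h3 : IsCoprime (t.2.2 : ℤ) t.1 := by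
            rw [e1]
            have h4 : IsCoprime (τ * (t.2.1 : ℤ)) t.1 :=
              (isCoprime_mul_unit_left_left hτ _ _).mpr
                (Nat.isCoprime_iff_coprime.mpr (h.cop t ht0)).symm
            rw [add_comm]
            exact IsCoprime.add_mul_right_left h4 σ
          refine h3.of_isCoprime_of_dvd_left ?_ |>.of_isCoprime_of_dvd_right ?_
          · exact_mod_cast Dvd.intro _ ht3
          · exact_mod_cast Dvd.intro _ ht1
        simp only
        generalize exactPart 1 t.1 = x at *
        generalize exactPart 1 t.2.1 = y at *
        generalize exactPart 1 s.1 = x' at *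
        generalize exactPart 1 s.2.1 = y' at *
        generalize exactPart 1 t.2.2 = z at *
        generalize exactPart 1 s.2.2 = z' at *
        rw [← ht1, ← ht2, ← ht3] at e1
        rw [← hs1, ← hs2, ← hs3] at e2
        push_cast at e1 e2
        have h3 : (u.2.2 : ℤ) ∣ u.1 * (σ * ((x : ℤ) * y' - x' * y)) :=
          ⟨z * y' - z' * y, by linear_combination (-y' : ℤ) * e1 + (y : ℤ) * e2⟩
        have h4 := hcop.dvd_of_dvd_mul_left h3
        rwa [hσ.dvd_mul_left] at h4
    refine Nat.le_floor ?_
    calc (#U : ℝ) ≤ ((8 * 2 ^ κ 1 * 2 ^ μ 1 / u.2.2 + 1 : ℕ) : ℝ) := by exact_mod_cast h2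
      _ ≤ 2 ^ (3 + (κ 1 : ℝ) + μ 1) / 2 ^ (∑ i ∈ Icc 1 5, ((i : ℕ) : ℝ) * ν i - ν 1 + ν 7) + 1 := by
        push_cast
        gcongr
        refine Nat.cast_div_le.trans ?_
        push_cast
        refine div_le_div₀ (by positivity) (le_of_eq ?_) (by positivity) hg
        rw [Real.rpow_add (by norm_num), Real.rpow_add (by norm_num)]
        norm_num
      _ ≤ 2 ^ (3 + e) + 2 ^ (3 + e) := by
        refine add_le_add ?_ (Real.one_le_rpow (by norm_num) (by linarith))
        rw [← Real.rpow_sub (by norm_num)]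
        exact Real.rpow_le_rpow_of_exponent_le (by norm_num) (by linarith)
      _ = 2 ^ (4 + e) := by
        rw [show 4 + e = (3 + e) + 1 by ring, Real.rpow_add_one (by norm_num)]
        ring
  set P := (T.image (·.1)).image (cofactor {1})
  set Q := (T.image (·.2.1)).image (cofactor {1})
  set R := (T.image (·.2.2)).image (cofactor {1})
  have h1 := card_le_mul_card_image_of_maps_to (s := T) (t := P ×ˢ Q ×ˢ R)
    (f := fun t => (cofactor {1} t.1, cofactor {1} t.2.1, cofactor {1} t.2.2)) (fun t ht =>
      mem_product.mpr ⟨mem_image_of_mem _ (mem_image_of_mem _ ht), mem_product.mpr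
        ⟨mem_image_of_mem _ (mem_image_of_mem _ ht), mem_image_of_mem _ (mem_image_of_mem _ ht)⟩⟩)
    _ (fun u _ => h_fiber u)
  rw [card_product, card_product] at h1
  have hP := h.fst.card_image_cofactor_le h.rad_le {1}
  have hQ := h.snd.card_image_cofactor_le h.rad_le {1}
  have hR := h.thd.card_image_cofactor_le h.rad_le {1}
  have h2 : (#T : ℝ) ≤ 2 ^ ((4 + e) + ((∑ i ∈ Icc 1 5 \ {1}, (κ i : ℝ) + κ 6 + 6 + d) +
      ((∑ i ∈ Icc 1 5 \ {1}, (μ i : ℝ) + μ 6 + 6 + d) +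
        (∑ i ∈ Icc 1 5 \ {1}, (ν i : ℝ) + ν 6 + 6 + d)))) := by
    have h2' : (0 : ℝ) < 2 := by norm_num
    calc (#T : ℝ) ≤ ((⌊(2 : ℝ) ^ (4 + e)⌋₊ * (#P * (#Q * #R)) : ℕ) : ℝ) := by exact_mod_cast h1
      _ ≤ _ := by
        rw [Real.rpow_add h2' (4 + e), Nat.cast_mul, Nat.cast_mul, Nat.cast_mul]
        refine mul_le_mul (Nat.floor_le (by positivity)) ?_ (by positivity) (by positivity)
        rw [Real.rpow_add h2']
        refine mul_le_mul hP ?_ (by positivity) (by positivity)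
        rw [Real.rpow_add h2']
        exact mul_le_mul hQ hR (by positivity) (by positivity)
  have hT0 : (0 : ℝ) < #T := by exact_mod_cast hT.card_pos
  have h4 := Real.logb_le_logb_of_le (b := 2) (by norm_num) hT0 h2
  rw [Real.logb_rpow (by norm_num) (by norm_num)] at h4
  have s1 := sum_sdiff (f := fun i => (κ i : ℝ)) h1m
  have s2 := sum_sdiff (f := fun i => (μ i : ℝ)) h1m
  have s3 := sum_sdiff (f := fun i => (ν i : ℝ)) h1m
  rw [sum_singleton] at s1 s2 s3
  simp only [sum_Icc_succ_top (show 1 ≤ 5 + 1 by norm_num)] at *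
  linarith

theorem logb_card_le (h : TripleBox T κ μ ν X d) (hT : T.Nonempty) :
    Real.logb 2 #T ≤ ∑ i ∈ Icc 1 6, (κ i : ℝ) + ∑ i ∈ Icc 1 6, (μ i : ℝ) + (12 + 2 * d) := by
  obtain ⟨σ, τ, hσ, hτ, hrel⟩ := h.rel
  have h1 : #T ≤ #(T.image (·.1)) * #(T.image (·.2.1)) := by
    rw [← card_product]
    refine card_le_card_of_injOn (fun t => (t.1, t.2.1)) (fun t ht => mem_product.mpr
      ⟨mem_image_of_mem _ ht, mem_image_of_mem _ ht⟩) fun x hx y hy hxy => ?_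
    obtain ⟨p1, p2⟩ := Prod.mk.inj hxy
    have p3 : x.2.2 = y.2.2 := by
      have := hrel x hx
      rw [p1, p2, ← hrel y hy] at this
      exact_mod_cast this
    exact Prod.ext p1 (Prod.ext p2 p3)
  have h2 : (#T : ℝ) ≤ 2 ^ ((∑ i ∈ Icc 1 5, (κ i : ℝ) + κ 6 + 6 + d) +
      (∑ i ∈ Icc 1 5, (μ i : ℝ) + μ 6 + 6 + d)) := by
    rw [Real.rpow_add (by norm_num)]
    calc (#T : ℝ) ≤ ((#(T.image (·.1)) * #(T.image (·.2.1)) : ℕ) : ℝ) := by exact_mod_cast h1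
      _ ≤ _ := by
        push_cast
        gcongr
        · exact h.fst.card_le h.rad_le
        · exact h.snd.card_le h.rad_le
  have hT0 : (0 : ℝ) < #T := by exact_mod_cast hT.card_pos
  have h4 := Real.logb_le_logb_of_le (b := 2) (by norm_num) hT0 h2
  rw [Real.logb_rpow (by norm_num) (by norm_num)] at h4
  simp only [sum_Icc_succ_top (show 1 ≤ 5 + 1 by norm_num)] at *
  linarith

end TripleBox

theorem rad_mul {m n : ℕ} (h : m.Coprime n) : rad (m * n) = rad m * rad n := by
  rw [rad, h.primeFactors_mul, prod_union h.disjoint_primeFactors, rad, rad]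

/-- The dyadic size of the integers with key `κ`. -/
def boxSize (κ : ℕ → ℕ) : ℕ := ∑ i ∈ Icc 1 5, i * κ i + κ 7

theorem two_pow_boxSize_le {n : ℕ} (hn : n ≠ 0) : 2 ^ boxSize (boxKey n) ≤ n := by
  refine (two_pow_le_cofactor ∅ n).trans (le_of_eq ?_)
  simpa using cofactor_mul_prod (empty_subset _) hn

theorem boxSize_lt_of_le {m n k : ℕ} (hm : m ≠ 0) (hn : n ≠ 0) (h : m ≤ 2 ^ k * n) :
    boxSize (boxKey m) < boxSize (boxKey n) + (16 + k) := by
  refine (Nat.pow_lt_pow_iff_right (a := 2) (by norm_num)).mp ?_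
  calc 2 ^ boxSize (boxKey m) ≤ m := two_pow_boxSize_le hm
    _ ≤ 2 ^ k * n := h
    _ < 2 ^ k * 2 ^ (boxSize (boxKey n) + 16) :=
      Nat.mul_lt_mul_of_pos_left (lt_two_pow_boxKey hn) (by positivity)
    _ = _ := by ring

theorem boxSize_cast (κ : ℕ → ℕ) :
    (boxSize κ : ℝ) = κ 1 + 2 * κ 2 + 3 * κ 3 + 4 * κ 4 + 5 * κ 5 + κ 7 := by
  rw [boxSize]
  push_cast
  rw [sum_Icc_one_five fun i => (i : ℝ) * κ i]
  push_cast
  ring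

namespace TripleBox

variable {T : Finset (ℕ × ℕ × ℕ)} {κ μ ν : ℕ → ℕ} {X : ℕ} {d : ℝ}

theorem card_image_swap_right (T : Finset (ℕ × ℕ × ℕ)) :
    #(T.image fun t => (t.1, t.2.2, t.2.1)) = #T :=
  card_image_of_injective _ fun x y h => by
    simp only [Prod.mk.injEq] at h
    exact Prod.ext h.1 (Prod.ext h.2.2 h.2.1)

theorem image_swap_right (h : TripleBox T κ μ ν X d) :
    TripleBox (T.image fun t => (t.1, t.2.2, t.2.1)) κ ν μ X d where
  rel := by
    obtain ⟨σ, τ, hσ, hτ, h1⟩ := h.rel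
    refine ⟨-(σ * τ), τ, (hσ.mul hτ).neg, hτ, fun t ht => ?_⟩
    obtain ⟨s, hs, rfl⟩ := mem_image.mp ht
    have h2 : τ * τ = 1 := Int.isUnit_mul_self hτ
    linear_combination (-τ) * h1 s hs - (s.2.1 : ℤ) * h2
  cop := fun t ht => by
    obtain ⟨s, hs, rfl⟩ := mem_image.mp ht
    obtain ⟨σ, τ, hσ, hτ, h1⟩ := h.rel
    have h2 := Nat.isCoprime_iff_coprime.mpr (h.cop s hs)
    rw [← Nat.isCoprime_iff_coprime, h1 s hs, add_comm]
    exact IsCoprime.add_mul_right_right ((isCoprime_mul_unit_left_right hτ _ _).mpr h2) σ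
  fst := by rw [image_image]; exact h.fst
  snd := by rw [image_image]; exact h.thd
  thd := by rw [image_image]; exact h.snd
  nonneg := h.nonneg
  divisors_le := h.divisors_le
  rad_le := h.rad_le

theorem logb_card_le_of_linear_program (h : TripleBox T κ μ ν X d) (hT : T.Nonempty) {S e : ℝ}
    (he : 60 + 9 * d ≤ e) (sκ : boxSize κ ≤ S + e) (sμ : boxSize μ ≤ S + e)
    (sμ' : S ≤ boxSize μ + e)
    (tot : ∑ i ∈ Icc 1 6, (κ i : ℝ) + ∑ i ∈ Icc 1 6, (μ i : ℝ) + ∑ i ∈ Icc 1 6, (ν i : ℝ) ≤ S + e)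
    (lin : 3 * ((κ 1 : ℝ) + μ 1) ≤ 2 * (∑ i ∈ Icc 1 6, (κ i : ℝ) + ∑ i ∈ Icc 1 6, (μ i : ℝ) +
      ∑ i ∈ Icc 1 6, (ν i : ℝ) - Real.logb 2 #T) + e) :
    Real.logb 2 #T ≤ 0.6588 * S + 10000 * e := by
  have hd := h.nonneg
  obtain ⟨t, ht⟩ := hT
  have wκ := six_mul_boxKey_six_le t.1
  have wμ := six_mul_boxKey_six_le t.2.1
  rw [(h.fst' ht).2.2] at wκ
  rw [(h.snd' ht).2.2] at wμ
  have hT : T.Nonempty := ⟨t, ht⟩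
  have hpq := h.pairBounds hT he
  have hqp := h.image_swap.pairBounds (hT.image _) he
  have tpq := h.logb_card_le hT
  have tp := h.image_swap_right.logb_card_le (hT.image _)
  have tq := h.image_swap.image_swap_right.logb_card_le ((hT.image _).image _)
  rw [card_image_swap_right] at tp tq
  rw [card_image_swap] at tq hqp
  rw [boxSize_cast] at sκ sμ sμ'
  rw [sum_Icc_one_six fun i => (κ i : ℝ)] at tpq tp lin tot
  rw [sum_Icc_one_six fun i => (μ i : ℝ)] at tpq tq lin tot
  exact PairBounds.le_of_linear_program (by linarith) (fun i => by positivity)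
    (fun i => by positivity) (by exact_mod_cast wκ) (by exact_mod_cast wμ) sκ sμ sμ' tot
    (by linarith) (by linarith) (by linarith) lin hpq hqp

theorem logb_card_le_of_rad_le (h : TripleBox T κ μ ν X d) (hT : T.Nonempty) {e : ℝ} (he : 0 ≤ e)
    (hadd : ∀ t ∈ T, t.1 + t.2.1 = t.2.2) (hle : ∀ t ∈ T, t.1 ≤ t.2.1)
    (hrad : ∀ t ∈ T, (rad (t.1 * t.2.1 * t.2.2) : ℝ) ≤ 2 ^ e * t.2.2) :
    Real.logb 2 #T ≤ 0.6588 * Real.logb 2 X + 10000 * (100 + 9 * d + 2 * e) := by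
  have hd := h.nonneg
  obtain ⟨t, ht⟩ := id hT
  obtain ⟨a0, -, hκ⟩ := h.fst' ht
  obtain ⟨b0, -, hμ⟩ := h.snd' ht
  obtain ⟨c0, cX, hν⟩ := h.thd' ht
  have hs := hadd t ht
  have hl := hle t ht
  have s1 := boxSize_lt_of_le (k := 0) a0 c0 (by lia)
  have s2 := boxSize_lt_of_le (k := 0) b0 c0 (by lia)
  have s3 := boxSize_lt_of_le (k := 1) c0 b0 (by lia)
  have s4 : (boxSize ν : ℝ) ≤ Real.logb 2 X := by
    rw [Real.le_logb_iff_rpow_le (by norm_num)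
      (by exact_mod_cast (Nat.pos_of_ne_zero c0).trans_le cX),
      Real.rpow_natCast]
    have := (two_pow_boxSize_le c0).trans cX
    rw [hν] at this
    exact_mod_cast this
  have hrad_mul : rad (t.1 * t.2.1 * t.2.2) = rad t.1 * rad t.2.1 * rad t.2.2 := by
    have h1 := h.cop t ht
    rw [rad_mul, rad_mul h1]
    rw [← hs]
    exact Nat.Coprime.mul_left (by simpa using h1) (by simpa using h1.symm)
  have tot : ∑ i ∈ Icc 1 6, (κ i : ℝ) + ∑ i ∈ Icc 1 6, (μ i : ℝ) + ∑ i ∈ Icc 1 6, (ν i : ℝ) ≤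
      boxSize ν + (16 + e) := by
    have h1 : (2 : ℝ) ^ (∑ i ∈ Icc 1 6, (κ i : ℝ) + ∑ i ∈ Icc 1 6, (μ i : ℝ) +
        ∑ i ∈ Icc 1 6, (ν i : ℝ)) ≤ 2 ^ (boxSize ν + (16 + e)) := by
      have h2 : 2 ^ (∑ i ∈ Icc 1 6, κ i + ∑ i ∈ Icc 1 6, μ i + ∑ i ∈ Icc 1 6, ν i) ≤
          rad (t.1 * t.2.1 * t.2.2) := by
        rw [hrad_mul, pow_add, pow_add, ← hκ, ← hμ, ← hν]
        exact Nat.mul_le_mul (Nat.mul_le_mul (two_pow_le_rad _) (two_pow_le_rad _))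
          (two_pow_le_rad _)
      have h3 : t.2.2 ≤ 2 ^ (boxSize ν + 16) := hν ▸ (lt_two_pow_boxKey c0).le
      calc _ = ((2 ^ (∑ i ∈ Icc 1 6, κ i + ∑ i ∈ Icc 1 6, μ i + ∑ i ∈ Icc 1 6, ν i) : ℕ) : ℝ) := by
            rw [Nat.cast_pow, ← Real.rpow_natCast]
            push_cast
            rfl
        _ ≤ 2 ^ e * t.2.2 := (Nat.cast_le.mpr h2).trans (hrad t ht)
        _ ≤ 2 ^ e * ((2 ^ (boxSize ν + 16) : ℕ) : ℝ) := by gcongr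
        _ = _ := by
            rw [Nat.cast_pow, ← Real.rpow_natCast, Nat.cast_ofNat, ← Real.rpow_add (by norm_num)]
            congr 1
            push_cast
            ring
    exact (Real.rpow_le_rpow_left_iff (by norm_num)).mp h1
  have hone : ∀ f : ℕ → ℕ, (f 1 : ℝ) ≤ ∑ i ∈ Icc 1 6, (f i : ℝ) := fun f =>
    single_le_sum (f := fun i => (f i : ℝ)) (fun i _ => by positivity) (by decide)
  have hlin := h.logb_card_le_sub hT (e := 16 + e) (by linarith) (by
    have h1 := hone κ
    have h2 := hone μ
    have h3 := hone ν
    have h4 : (boxSize ν : ℝ) = ∑ i ∈ Icc 1 5, ((i : ℕ) : ℝ) * ν i + ν 7 := by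
      rw [boxSize]
      push_cast
      rfl
    linarith)
  rw [hκ, hν] at s1
  rw [hμ, hν] at s2 s3
  have s1' : (boxSize κ : ℝ) ≤ boxSize ν + 16 := by exact_mod_cast s1.le
  have s2' : (boxSize μ : ℝ) ≤ boxSize ν + 16 := by exact_mod_cast s2.le
  have s3' : (boxSize ν : ℝ) ≤ boxSize μ + 17 := by exact_mod_cast s3.le
  suffices Real.logb 2 #T ≤ 0.6588 * boxSize ν + 10000 * (100 + 9 * d + 2 * e) by linarith
  by_cases hmin : κ 1 ≤ ν 1 ∧ μ 1 ≤ ν 1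
  · have h1 : (κ 1 : ℝ) ≤ ν 1 := by exact_mod_cast hmin.1
    have h2 : (μ 1 : ℝ) ≤ ν 1 := by exact_mod_cast hmin.2
    exact h.logb_card_le_of_linear_program hT (by linarith) (by linarith) (by linarith)
      (by linarith) (by linarith) (by linarith)
  by_cases hmin' : κ 1 ≤ μ 1
  · have h1 : (κ 1 : ℝ) ≤ μ 1 := by exact_mod_cast hmin'
    have h2 : (ν 1 : ℝ) ≤ μ 1 := by exact_mod_cast (by lia : ν 1 ≤ μ 1)
    have h3 := h.image_swap_right.logb_card_le_of_linear_program (hT.image _)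
      (S := boxSize ν) (e := 100 + 9 * d + 2 * e)
    rw [card_image_swap_right] at h3
    exact h3 (by linarith) (by linarith) (by linarith)
      (by linarith) (by linarith) (by linarith)
  · have h1 : (μ 1 : ℝ) ≤ κ 1 := by exact_mod_cast (by lia : μ 1 ≤ κ 1)
    have h2 : (ν 1 : ℝ) ≤ κ 1 := by exact_mod_cast (by lia : ν 1 ≤ κ 1)
    have h3 := h.image_swap.image_swap_right.logb_card_le_of_linear_program
      ((hT.image _).image _) (S := boxSize ν) (e := 100 + 9 * d + 2 * e)
    rw [card_image_swap_right, card_image_swap] at h3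
    exact h3 (by linarith) (by linarith) (by linarith)
      (by linarith) (by linarith) (by linarith)

end TripleBox

theorem boxKey_le_log {n : ℕ} (hn : n ≠ 0) (i : ℕ) : boxKey n i ≤ Nat.log 2 n := by
  have h := prod_exactPart_pow_mul_tailPart hn
  have h6 : tailPart n ∣ n := Dvd.intro_left _ h
  rw [boxKey]
  split_ifs with h1 h2 h3
  · refine Nat.log_mono_right (Nat.le_of_dvd (Nat.pos_of_ne_zero hn) ?_)
    have h2 : i ≠ 0 := by have := mem_Icc.mp h1; lia
    exact ((dvd_pow_self _ h2).trans
      (dvd_prod_of_mem (fun i => exactPart i n ^ i) h1)).trans (Dvd.intro _ h)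
  · exact Nat.log_mono_right (Nat.le_of_dvd (Nat.pos_of_ne_zero hn)
      ((rad_dvd _).trans h6))
  · exact Nat.log_mono_right (Nat.le_of_dvd (Nat.pos_of_ne_zero hn) h6)
  · exact Nat.zero_le _

theorem boxKey_eq_of_forall_fin {m n : ℕ} (h : ∀ i : Fin 8, boxKey m i = boxKey n i) :
    boxKey m = boxKey n := by
  funext i
  by_cases hi : i < 8
  · exact h ⟨i, hi⟩
  · have h1 : i ∉ Icc 1 5 := by rw [mem_Icc]; lia
    simp only [boxKey, h1, if_false, (by lia : i ≠ 6), (by lia : i ≠ 7)]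

/-- The ordered triples `a + b = c` of coprime positive integers up to `X` with
`rad (a * b * c) ≤ 2 ^ e * c`. -/
noncomputable def orderedTriples (X : ℕ) (e : ℝ) : Finset (ℕ × ℕ × ℕ) :=
  {t ∈ Icc 1 X ×ˢ Icc 1 X ×ˢ Icc 1 X | t.1 + t.2.1 = t.2.2 ∧ t.1.Coprime t.2.1 ∧ t.1 ≤ t.2.1 ∧
    (rad (t.1 * t.2.1 * t.2.2) : ℝ) ≤ 2 ^ e * t.2.2}

theorem card_orderedTriples_le {X : ℕ} {d e : ℝ} (hd : 0 ≤ d) (he : 0 ≤ e)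
    (hdiv : ∀ n, n ≠ 0 → n ≤ X → (#n.divisors : ℝ) ≤ 2 ^ d)
    (hrad : ∀ m, (#{n ∈ Icc 1 X | rad n = m} : ℝ) ≤ 2 ^ d) :
    (#(orderedTriples X e) : ℝ) ≤
      2 ^ (0.6588 * Real.logb 2 X + 10000 * (100 + 9 * d + 2 * e)) * (Nat.log 2 X + 1) ^ 24 := by
  set B : ℝ := 2 ^ (0.6588 * Real.logb 2 X + 10000 * (100 + 9 * d + 2 * e))
  set key : ℕ → Fin 8 → ℕ := fun n i => boxKey n i
  set P := Fintype.piFinset fun _ : Fin 8 => range (Nat.log 2 X + 1)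
  have hkey : ∀ n ∈ Icc 1 X, key n ∈ P := fun n hn => by
    obtain ⟨h1, h2⟩ := mem_Icc.mp hn
    refine Fintype.mem_piFinset.mpr fun i => mem_range.mpr (Nat.lt_succ_of_le ?_)
    exact (boxKey_le_log (by lia) i).trans (Nat.log_mono_right h2)
  have hmem : ∀ t ∈ orderedTriples X e, t.1 ∈ Icc 1 X ∧ t.2.1 ∈ Icc 1 X ∧ t.2.2 ∈ Icc 1 X :=
    fun t ht => by
      have h1 := (mem_filter.mp ht).1
      rwa [mem_product, mem_product] at h1
  have h1 := card_le_mul_card_image_of_maps_to (s := orderedTriples X e) (t := P ×ˢ P ×ˢ P)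
    (f := fun t => (key t.1, key t.2.1, key t.2.2)) (fun t ht => by
      obtain ⟨h1, h2, h3⟩ := hmem t ht
      exact mem_product.mpr ⟨hkey _ h1, mem_product.mpr ⟨hkey _ h2, hkey _ h3⟩⟩) ⌊B⌋₊ ?_
  · rw [card_product, card_product, Fintype.card_piFinset] at h1
    simp only [card_range, prod_const, card_univ, Fintype.card_fin] at h1
    calc (#(orderedTriples X e) : ℝ) ≤ (⌊B⌋₊ * ((Nat.log 2 X + 1) ^ 8 * ((Nat.log 2 X + 1) ^ 8 *
          (Nat.log 2 X + 1) ^ 8)) : ℕ) := by exact_mod_cast h1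
      _ = ⌊B⌋₊ * ((Nat.log 2 X : ℝ) + 1) ^ 24 := by push_cast; ring
      _ ≤ _ := by
        gcongr
        exact Nat.floor_le (by positivity)
  · intro u _
    refine Nat.le_floor ?_
    set T := {t ∈ orderedTriples X e | (key t.1, key t.2.1, key t.2.2) = u}
    rcases T.eq_empty_or_nonempty with h0 | hT
    · rw [h0, card_empty, Nat.cast_zero]
      positivity
    obtain ⟨s, hs⟩ := id hT
    have hT' : ∀ t ∈ T, t ∈ orderedTriples X e ∧ boxKey t.1 = boxKey s.1 ∧
        boxKey t.2.1 = boxKey s.2.1 ∧ boxKey t.2.2 = boxKey s.2.2 := fun t ht => by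
      obtain ⟨h2, h3⟩ := mem_filter.mp ht
      have h4 := h3.trans (mem_filter.mp hs).2.symm
      simp only [Prod.mk.injEq] at h4
      exact ⟨h2, boxKey_eq_of_forall_fin (congrFun h4.1),
        boxKey_eq_of_forall_fin (congrFun h4.2.1), boxKey_eq_of_forall_fin (congrFun h4.2.2)⟩
    have hbox : TripleBox T (boxKey s.1) (boxKey s.2.1) (boxKey s.2.2) X d := by
      refine ⟨⟨1, 1, isUnit_one, isUnit_one, fun t ht => ?_⟩, fun t ht => ?_, fun n hn => ?_,
        fun n hn => ?_, fun n hn => ?_, hd, hdiv, hrad⟩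
      · have := (mem_filter.mp (hT' t ht).1).2.1
        lia
      · exact (mem_filter.mp (hT' t ht).1).2.2.1
      all_goals
        obtain ⟨t, ht, rfl⟩ := mem_image.mp hn
        obtain ⟨h2, h3, h4, h5⟩ := hT' t ht
        have h6 := hmem t h2
        simp only [mem_Icc] at h6
      · exact ⟨by lia, by lia, h3⟩
      · exact ⟨by lia, by lia, h4⟩
      · exact ⟨by lia, by lia, h5⟩
    have h2 := hbox.logb_card_le_of_rad_le hT he (fun t ht => (mem_filter.mp (hT' t ht).1).2.1)
      (fun t ht => (mem_filter.mp (hT' t ht).1).2.2.2.1)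
      (fun t ht => (mem_filter.mp (hT' t ht).1).2.2.2.2)
    rwa [Real.logb_le_iff_le_rpow (by norm_num) (by exact_mod_cast hT.card_pos)] at h2

theorem Nat.log_two_add_one_le {η : ℝ} (hη : 0 < η) {X : ℕ} (hX : 1 ≤ X) :
    (Nat.log 2 X : ℝ) + 1 ≤ (1 / (η * Real.log 2) + 1) * (X : ℝ) ^ η := by
  have hX' : (1 : ℝ) ≤ X := by exact_mod_cast hX
  have h2 : 0 < Real.log 2 := Real.log_pos (by norm_num)
  have h1 : (Nat.log 2 X : ℝ) ≤ Real.logb 2 X := by exact_mod_cast Real.natLog_le_logb X 2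
  have h3 := Real.log_le_rpow_div (by linarith : (0 : ℝ) ≤ X) hη
  have h4 := Real.one_le_rpow hX' hη.le
  have h5 : Real.logb 2 X ≤ 1 / (η * Real.log 2) * (X : ℝ) ^ η := by
    rw [Real.logb, div_le_iff₀ h2]
    refine h3.trans (le_of_eq ?_)
    field_simp
  linarith

theorem exists_card_orderedTriples_le : ∃ C : ℝ, 0 ≤ C ∧ ∀ X : ℕ, 1 ≤ X →
    (#(orderedTriples X (10⁻¹ ^ 10 * Real.logb 2 X)) : ℝ) ≤ C * (X : ℝ) ^ (56 / 85 : ℝ) := by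
  obtain ⟨C₁, hC₁, h₁⟩ := Nat.exists_card_divisors_le_rpow (ε := 10⁻¹ ^ 11) (by norm_num)
  obtain ⟨C₂, hC₂, h₂⟩ := exists_card_rad_eq_le (η := 10⁻¹ ^ 11) (by norm_num)
  set η : ℝ := 10⁻¹ ^ 11
  set K : ℝ := 1 / (10⁻¹ ^ 7 * Real.log 2) + 1
  have hK : 0 ≤ K := by
    have : 0 < Real.log 2 := Real.log_pos (by norm_num)
    positivity
  set D : ℝ := Real.logb 2 (C₁ * C₂)
  refine ⟨2 ^ (10000 * (100 + 9 * D)) * K ^ 24, by positivity, fun X hX => ?_⟩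
  have hX' : (1 : ℝ) ≤ X := by exact_mod_cast hX
  set x := Real.logb 2 X
  have hx : 0 ≤ x := Real.logb_nonneg (by norm_num) hX'
  have hD : 0 ≤ D := Real.logb_nonneg (by norm_num) (by nlinarith)
  have hXx : ∀ s : ℝ, (X : ℝ) ^ s = 2 ^ (s * x) := fun s => by
    rw [mul_comm, Real.rpow_mul (by norm_num), Real.rpow_logb (by norm_num) (by norm_num)
      (by linarith)]
  have hd : (2 : ℝ) ^ (D + η * x) = C₁ * C₂ * (X : ℝ) ^ η := by
    rw [hXx, Real.rpow_add (by norm_num), Real.rpow_logb (by norm_num) (by norm_num)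
      (by nlinarith)]
  have h3 := card_orderedTriples_le (X := X) (d := D + η * x) (e := 10⁻¹ ^ 10 * x) (by positivity)
    (by positivity) ?_ ?_
  · have h4 := Nat.log_two_add_one_le (η := 10⁻¹ ^ 7) (by norm_num) hX
    refine h3.trans ?_
    calc _ ≤ 2 ^ (0.6588 * x + 10000 * (100 + 9 * (D + η * x) + 2 * (10⁻¹ ^ 10 * x))) *
          (K * (X : ℝ) ^ (10⁻¹ ^ 7 : ℝ)) ^ 24 := by gcongr
      _ = 2 ^ (10000 * (100 + 9 * D)) * K ^ 24 * 2 ^ (0.6588 * x +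
          10000 * (9 * (η * x) + 2 * (10⁻¹ ^ 10 * x)) + 10⁻¹ ^ 7 * x * 24) := by
        rw [mul_pow, hXx, ← Real.rpow_mul_natCast (by norm_num), mul_left_comm,
          mul_comm (_ ^ (10000 * (100 + 9 * D))) (K ^ 24), mul_assoc (K ^ 24),
          ← Real.rpow_add (by norm_num), ← Real.rpow_add (by norm_num)]
        congr 2
        push_cast
        ring
      _ ≤ _ := by
        rw [hXx]
        gcongr
        · norm_num
        · norm_num [η]
          linarith
  · intro n hn hnX
    rw [hd]
    refine (h₁ n hn).trans ?_
    gcongr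
    nlinarith
  · intro m
    rw [hd]
    refine (h₂ X m hX).trans ?_
    gcongr
    nlinarith

theorem NabcCount_le {lam δ X : ℝ} (hδ : 0 ≤ δ) (hlam : lam ≤ 1 + δ) :
    NabcCount lam X ≤ 2 * #(orderedTriples ⌊X⌋₊ (δ * Real.logb 2 ⌊X⌋₊)) := by
  set T := orderedTriples ⌊X⌋₊ (δ * Real.logb 2 ⌊X⌋₊)
  have hmem : ∀ a b c : ℕ, IsABCTriple lam a b c → (c : ℝ) ≤ X → a ≤ b → (a, b, c) ∈ T := by
    rintro a b c ⟨ha, hb, hc, hab, habc, hrad⟩ hcX hle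
    have h1 : c ≤ ⌊X⌋₊ := Nat.le_floor hcX
    have hc' : (1 : ℝ) ≤ c := by exact_mod_cast hc
    have h1' : (c : ℝ) ≤ ⌊X⌋₊ := by exact_mod_cast h1
    refine mem_filter.mpr ⟨?_, habc, hab, hle, hrad.le.trans ?_⟩
    · simp only [mem_product, mem_Icc]
      lia
    · calc (c : ℝ) ^ lam ≤ (c : ℝ) ^ (1 + δ) := Real.rpow_le_rpow_of_exponent_le hc' hlam
        _ = (c : ℝ) ^ δ * c := by
          rw [add_comm, Real.rpow_add_one (by positivity)]
        _ ≤ (⌊X⌋₊ : ℝ) ^ δ * c := by gcongr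
        _ = _ := by
          rw [mul_comm δ, Real.rpow_mul (by norm_num), Real.rpow_logb (by norm_num) (by norm_num)
            (by linarith)]
  have hsub : {t : ℕ × ℕ × ℕ | IsABCTriple lam t.1 t.2.1 t.2.2 ∧
      (t.1 : ℝ) ≤ X ∧ (t.2.1 : ℝ) ≤ X ∧ (t.2.2 : ℝ) ≤ X} ⊆
      (T ∪ T.image fun t => (t.2.1, t.1, t.2.2) : Finset (ℕ × ℕ × ℕ)) := by
    rintro ⟨a, b, c⟩ ⟨h, -, -, hc⟩
    rw [mem_coe, mem_union]
    rcases le_total a b with hle | hle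
    · exact .inl (hmem a b c h hc hle)
    · refine .inr (mem_image.mpr ⟨(b, a, c), hmem b a c ?_ hc hle, rfl⟩)
      obtain ⟨ha, hb, hc, hab, habc, hrad⟩ := h
      exact ⟨hb, ha, hc, Nat.gcd_comm a b ▸ hab, by lia, by rwa [mul_comm b a]⟩
  calc NabcCount lam X ≤ #(T ∪ T.image fun t => (t.2.1, t.1, t.2.2)) := by
        rw [← Set.ncard_coe_finset]
        exact Set.ncard_le_ncard hsub (finite_toSet _)
    _ ≤ _ := (card_union_le _ _).trans (by rw [TripleBox.card_image_swap, two_mul])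

theorem abc_count_bound :
    ∀ ε : ℝ, 0 < ε → ∃ δ : ℝ, 0 < δ ∧ ∃ C : ℝ,
      ∀ lam : ℝ, 0 < lam → lam < 1 + δ →
        ∀ X : ℝ, 2 ≤ X →
          (NabcCount lam X : ℝ) ≤ C * X ^ (56 / 85 + ε : ℝ) := by
  intro ε hε
  obtain ⟨C, hC, h⟩ := exists_card_orderedTriples_le
  refine ⟨10⁻¹ ^ 10, by norm_num, 2 * C, fun lam _ hlam X hX => ?_⟩
  have h1 : 1 ≤ ⌊X⌋₊ := Nat.le_floor (by push_cast; linarith)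
  calc (NabcCount lam X : ℝ) ≤
        ((2 * #(orderedTriples ⌊X⌋₊ (10⁻¹ ^ 10 * Real.logb 2 ⌊X⌋₊)) : ℕ) : ℝ) := by
        exact_mod_cast NabcCount_le (by norm_num) hlam.le
    _ ≤ 2 * C * (⌊X⌋₊ : ℝ) ^ (56 / 85 : ℝ) := by
      push_cast
      linarith [h _ h1]
    _ ≤ 2 * C * X ^ (56 / 85 : ℝ) := by
      gcongr
      exact Nat.floor_le (by linarith)
    _ ≤ _ := by
      gcongr
      · linarith
      · linarith
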